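/- arXiv:2301.09036 — 3 statements merged into one kernel-verified Lean document; each statement's English description precedes it below -/
import Mathlib

section
/- Let G be a finite simple 3-regular bipartite graph. Then 16·M(G,4) = N(P₃+3K₂) + 4·N(C₄+2K₂) + 2·N(P₄+2K₂) + N(P₅+K₂). -/
open SimpleGraph

/-- The number of `k`-matchings of a graph `G`: `k`-element sets of pairwise disjoint
edges of `G`, identified with the matching subgraphs of `G` having exactly `k` edges. -/
noncomputable def numMatchings {V : Type*} (G : SimpleGraph V) (k : ℕ) : ℕ :=
  Set.ncard {H : G.Subgraph | H.IsMatching ∧ H.edgeSet.ncard = k}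

/-- The number of subgraphs of `G` isomorphic to the graph `X`. -/
noncomputable def numSubgraphs {V W : Type*} (G : SimpleGraph V) (X : SimpleGraph W) : ℕ :=
  Set.ncard {H : G.Subgraph | Nonempty (H.coe ≃g X)}

/-- A path `x u v y` in `K` such that the vertices `u` and `v` have no further neighbours, and every
vertex has at most one neighbour once `u` and `v` are removed. -/
def IsFlag {V : Type*} (K : SimpleGraph V) (u v x y : V) : Prop :=
  K.Adj u v ∧ (K.Adj u x ∧ x ≠ v) ∧ (K.Adj v y ∧ y ≠ u) ∧ x ≠ y ∧
    (∀ b, K.Adj u b → b = v ∨ b = x) ∧ (∀ b, K.Adj v b → b = u ∨ b = y) ∧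
    ∀ a, a ≠ u → a ≠ v → ∀ b, K.Adj a b → b ≠ u → b ≠ v →
      ∀ c, K.Adj a c → c ≠ u → c ≠ v → b = c

/-- The edge `u v` is the middle edge of a flag `x u v y` of the kind selected by `κ`, which looks at
whether `x` and `y` are adjacent, whether `x` has a neighbour other than `u`, and whether `y` has
a neighbour other than `v`. -/
def HasFlag {V : Type*} (κ : Prop → Prop → Prop → Prop) (K : SimpleGraph V) (u v : V) : Prop :=
  K.Adj u v ∧ ∃ x, (K.Adj u x ∧ x ≠ v) ∧ ∃ y, (K.Adj v y ∧ y ≠ u) ∧ IsFlag K u v x y ∧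
    κ (K.Adj x y) (∃ z, K.Adj x z ∧ z ≠ u) (∃ z, K.Adj y z ∧ z ≠ v)

/-- The flags whose outer vertices have degree one. -/
abbrev kindPathThree (_ p q : Prop) : Prop := ¬p ∧ ¬q

/-- The flags whose outer vertices are adjacent. -/
abbrev kindCycleFour (r _ _ : Prop) : Prop := r

/-- The flags for which exactly one of the outer vertices has degree one. -/
abbrev kindPathFour (_ p q : Prop) : Prop := ¬(p ∧ q) ∧ (p ∨ q)

/-- The flags whose outer vertices are not adjacent and have further neighbours. -/
abbrev kindPathFive (r p q : Prop) : Prop := ¬r ∧ p ∧ q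

instance {V : Type*} [Fintype V] [DecidableEq V] (K : SimpleGraph V) [DecidableRel K.Adj]
    (u v x y : V) : Decidable (IsFlag K u v x y) := by
  unfold IsFlag; infer_instance

instance {n : ℕ} : DecidableRel (pathGraph n).Adj :=
  fun _ _ => decidable_of_iff _ pathGraph_adj.symm

instance {n : ℕ} : DecidableRel (cycleGraph n).Adj :=
  fun _ _ => decidable_of_iff _ cycleGraph_adj'.symm

instance {V W : Type*} (G : SimpleGraph V) (H : SimpleGraph W) [DecidableRel G.Adj]
    [DecidableRel H.Adj] : DecidableRel (G ⊕g H).Adj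
  | .inl u, .inl v => inferInstanceAs (Decidable (G.Adj u v))
  | .inr u, .inr v => inferInstanceAs (Decidable (H.Adj u v))
  | .inl _, .inr _ => inferInstanceAs (Decidable (false = true))
  | .inr _, .inl _ => inferInstanceAs (Decidable (false = true))

instance {V : Type*} [Fintype V] [DecidableEq V] (K : SimpleGraph V) [DecidableRel K.Adj]
    (u v : V) : Decidable (HasFlag kindPathThree K u v) := by
  unfold HasFlag; infer_instance

instance {V : Type*} [Fintype V] [DecidableEq V] (K : SimpleGraph V) [DecidableRel K.Adj]
    (u v : V) : Decidable (HasFlag kindCycleFour K u v) := by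
  unfold HasFlag; infer_instance

instance {V : Type*} [Fintype V] [DecidableEq V] (K : SimpleGraph V) [DecidableRel K.Adj]
    (u v : V) : Decidable (HasFlag kindPathFour K u v) := by
  unfold HasFlag; infer_instance

instance {V : Type*} [Fintype V] [DecidableEq V] (K : SimpleGraph V) [DecidableRel K.Adj]
    (u v : V) : Decidable (HasFlag kindPathFive K u v) := by
  unfold HasFlag; infer_instance

theorem IsFlag.symm {V : Type*} {K : SimpleGraph V} {u v x y : V} (h : IsFlag K u v x y) :
    IsFlag K v u y x := by
  obtain ⟨h1, h2, h3, h4, h5, h6, h7⟩ := h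
  exact ⟨h1.symm, h3, h2, h4.symm, h6, h5, fun a hu hv b hb hbu hbv c hc hcu hcv =>
    h7 a hv hu b hb hbv hbu c hc hcv hcu⟩

theorem exists_adj_notMem_of_card_lt {V : Type*} {K : SimpleGraph V} {S : Finset (Sym2 V)}
    (h : S.card < K.edgeSet.ncard) : ∃ a b, K.Adj a b ∧ s(a, b) ∉ S := by
  obtain ⟨e, he, hS⟩ := Set.exists_mem_notMem_of_ncard_lt_ncard
    (s := (S : Set (Sym2 V))) (t := K.edgeSet) (by simpa using h)
  induction e with
  | h a b => exact ⟨a, b, he, by simpa using hS⟩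

theorem map_eq_of_ncard_edgeSet_eq {V W : Type*} [Finite V] {X : SimpleGraph W} {K : SimpleGraph V}
    (f : W ↪ V) (hf : ∀ i j, X.Adj i j → K.Adj (f i) (f j))
    (h : X.edgeSet.ncard = K.edgeSet.ncard) : X.map f = K := by
  have hle : X.map f ≤ K := by
    rintro a b ⟨hab, i, j, hij, rfl, rfl⟩
    exact hf i j hij
  have hcard : (X.map f).edgeSet.ncard = X.edgeSet.ncard := by
    rw [edgeSet_map, Set.ncard_image_of_injective _ (Function.Embedding.injective _)]
  refine edgeSet_injective (Set.eq_of_subset_of_ncard_le (edgeSet_mono hle) ?_ (Set.toFinite _))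
  omega

theorem ncard_edgeSet_pathThree :
    (pathGraph 4 ⊕g pathGraph 2 ⊕g pathGraph 2 ⊕g pathGraph 2).edgeSet.ncard = 6 := by
  rw [← coe_edgeFinset, Set.ncard_coe_finset]
  decide +kernel

theorem ncard_edgeSet_cycleFour :
    (cycleGraph 4 ⊕g pathGraph 2 ⊕g pathGraph 2).edgeSet.ncard = 6 := by
  rw [← coe_edgeFinset, Set.ncard_coe_finset]
  decide +kernel

theorem ncard_edgeSet_pathFour :
    (pathGraph 5 ⊕g pathGraph 2 ⊕g pathGraph 2).edgeSet.ncard = 6 := by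
  rw [← coe_edgeFinset, Set.ncard_coe_finset]
  decide +kernel

theorem ncard_edgeSet_pathFive : (pathGraph 6 ⊕g pathGraph 2).edgeSet.ncard = 6 := by
  rw [← coe_edgeFinset, Set.ncard_coe_finset]
  decide +kernel

theorem IsFlag.ne_of_adj {V : Type*} {K : SimpleGraph V} {u v x y a b : V}
    (h : IsFlag K u v x y) (hab : K.Adj a b) (huv : s(a, b) ≠ s(u, v)) (hux : s(a, b) ≠ s(u, x))
    (hvy : s(a, b) ≠ s(v, y)) : (a ≠ u ∧ a ≠ v) ∧ b ≠ u ∧ b ≠ v := by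
  obtain ⟨-, -, -, -, hu, hv, -⟩ := h
  have := hab.symm
  grind

theorem IsFlag.ne_of_adj_of_adj {V : Type*} {K : SimpleGraph V} {u v x y a b c d : V}
    (h : IsFlag K u v x y) (hab : K.Adj a b) (hcd : K.Adj c d) (ha : (a ≠ u ∧ a ≠ v) ∧ b ≠ u ∧ b ≠ v)
    (hc : (c ≠ u ∧ c ≠ v) ∧ d ≠ u ∧ d ≠ v) (hne : s(c, d) ≠ s(a, b)) :
    (a ≠ c ∧ a ≠ d) ∧ b ≠ c ∧ b ≠ d := by
  obtain ⟨-, -, -, -, -, -, hm⟩ := h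
  have := hab.symm
  have := hcd.symm
  grind

theorem exists_map_pathThree_eq {V : Type*} [Finite V] {K : SimpleGraph V}
    (hK : K.edgeSet.ncard = 6) {u v x y : V} (h : IsFlag K u v x y)
    (hx : ∀ z, K.Adj x z → z = u) (hy : ∀ z, K.Adj y z → z = v) :
    ∃ f : (((Fin 4 ⊕ Fin 2) ⊕ Fin 2) ⊕ Fin 2) ↪ V,
      (pathGraph 4 ⊕g pathGraph 2 ⊕g pathGraph 2 ⊕g pathGraph 2).map f = K := by
  classical
  obtain ⟨huv, ⟨hux, hxv⟩, ⟨hvy, hyu⟩, hxy, -⟩ := id h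
  obtain ⟨a, b, hab, habS⟩ := exists_adj_notMem_of_card_lt (K := K)
    (S := {s(u, v), s(u, x), s(v, y)}) (hK ▸ Finset.card_le_three.trans_lt (by simp))
  obtain ⟨c, d, hcd, hcdS⟩ := exists_adj_notMem_of_card_lt (K := K)
    (S := {s(u, v), s(u, x), s(v, y), s(a, b)}) (hK ▸ Finset.card_le_four.trans_lt (by simp))
  obtain ⟨e, g, heg, hegS⟩ := exists_adj_notMem_of_card_lt (K := K)
    (S := {s(u, v), s(u, x), s(v, y), s(a, b), s(c, d)})
    (hK ▸ Finset.card_le_five.trans_lt (by simp))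
  simp only [Finset.mem_insert, Finset.mem_singleton, not_or] at habS hcdS hegS
  have hab' := h.ne_of_adj hab habS.1 habS.2.1 habS.2.2
  have hcd' := h.ne_of_adj hcd hcdS.1 hcdS.2.1 hcdS.2.2.1
  have := h.ne_of_adj_of_adj hab hcd hab' hcd' hcdS.2.2.2
  have heg' := h.ne_of_adj heg hegS.1 hegS.2.1 hegS.2.2.1
  have := h.ne_of_adj_of_adj hab heg hab' heg' hegS.2.2.2.1
  have := h.ne_of_adj_of_adj hcd heg hcd' heg' hegS.2.2.2.2
  have := huv.ne; have := hux.ne; have := hvy.ne; have := hab.ne; have := hcd.ne; have := heg.ne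
  have := huv.symm; have := hux.symm; have := hvy.symm
  have := hab.symm; have := hcd.symm; have := heg.symm
  refine ⟨⟨Sum.elim (Sum.elim (Sum.elim ![x, u, v, y] ![a, b]) ![c, d]) ![e, g], ?_⟩,
    map_eq_of_ncard_edgeSet_eq _ ?_ (ncard_edgeSet_pathThree.trans hK.symm)⟩
  · refine ((Function.Injective.sumElim ?_ ?_ ?_).sumElim ?_ ?_).sumElim ?_ ?_ <;>
      simp [Function.Injective, Fin.forall_fin_succ] <;> grind
  · simp [Fin.forall_fin_succ, pathGraph_adj, *]

theorem exists_map_cycleFour_eq {V : Type*} [Finite V] {K : SimpleGraph V}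
    (hK : K.edgeSet.ncard = 6) {u v x y : V} (h : IsFlag K u v x y) (hadj : K.Adj x y) :
    ∃ f : ((Fin 4 ⊕ Fin 2) ⊕ Fin 2) ↪ V,
      (cycleGraph 4 ⊕g pathGraph 2 ⊕g pathGraph 2).map f = K := by
  classical
  obtain ⟨huv, ⟨hux, hxv⟩, ⟨hvy, hyu⟩, hxy, -⟩ := id h
  obtain ⟨a, b, hab, habS⟩ := exists_adj_notMem_of_card_lt (K := K)
    (S := {s(u, v), s(u, x), s(v, y), s(x, y)}) (hK ▸ Finset.card_le_four.trans_lt (by simp))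
  obtain ⟨c, d, hcd, hcdS⟩ := exists_adj_notMem_of_card_lt (K := K)
    (S := {s(u, v), s(u, x), s(v, y), s(x, y), s(a, b)})
    (hK ▸ Finset.card_le_five.trans_lt (by simp))
  simp only [Finset.mem_insert, Finset.mem_singleton, not_or] at habS hcdS
  have hadj' : (x ≠ u ∧ x ≠ v) ∧ y ≠ u ∧ y ≠ v := ⟨⟨hux.ne', hxv⟩, hyu, hvy.ne'⟩
  have hab' := h.ne_of_adj hab habS.1 habS.2.1 habS.2.2.1
  have := h.ne_of_adj_of_adj hadj hab hadj' hab' habS.2.2.2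
  have hcd' := h.ne_of_adj hcd hcdS.1 hcdS.2.1 hcdS.2.2.1
  have := h.ne_of_adj_of_adj hadj hcd hadj' hcd' hcdS.2.2.2.1
  have := h.ne_of_adj_of_adj hab hcd hab' hcd' hcdS.2.2.2.2
  have := huv.ne; have := hux.ne; have := hvy.ne; have := hab.ne; have := hcd.ne
  have := huv.symm; have := hux.symm; have := hvy.symm
  have := hab.symm; have := hcd.symm; have := hadj.symm
  refine ⟨⟨Sum.elim (Sum.elim ![x, u, v, y] ![a, b]) ![c, d], ?_⟩,
    map_eq_of_ncard_edgeSet_eq _ ?_ (ncard_edgeSet_cycleFour.trans hK.symm)⟩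
  · refine (Function.Injective.sumElim ?_ ?_ ?_).sumElim ?_ ?_ <;>
      simp [Function.Injective, Fin.forall_fin_succ] <;> grind
  · simp [Fin.forall_fin_succ, pathGraph_adj, cycleGraph_adj', *]
    exact ⟨fun h => absurd h (by decide), fun h => absurd h (by decide)⟩

theorem exists_map_pathFour_eq {V : Type*} [Finite V] {K : SimpleGraph V}
    (hK : K.edgeSet.ncard = 6) {u v x y z : V} (h : IsFlag K u v x y) (hxz : K.Adj x z)
    (hzu : z ≠ u) (hy : ∀ z, K.Adj y z → z = v) :
    ∃ f : ((Fin 5 ⊕ Fin 2) ⊕ Fin 2) ↪ V,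
      (pathGraph 5 ⊕g pathGraph 2 ⊕g pathGraph 2).map f = K := by
  classical
  obtain ⟨huv, ⟨hux, hxv⟩, ⟨hvy, hyu⟩, hxy, -⟩ := id h
  obtain ⟨a, b, hab, habS⟩ := exists_adj_notMem_of_card_lt (K := K)
    (S := {s(u, v), s(u, x), s(v, y), s(x, z)}) (hK ▸ Finset.card_le_four.trans_lt (by simp))
  obtain ⟨c, d, hcd, hcdS⟩ := exists_adj_notMem_of_card_lt (K := K)
    (S := {s(u, v), s(u, x), s(v, y), s(x, z), s(a, b)})
    (hK ▸ Finset.card_le_five.trans_lt (by simp))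
  simp only [Finset.mem_insert, Finset.mem_singleton, not_or] at habS hcdS
  have hxz' : (x ≠ u ∧ x ≠ v) ∧ z ≠ u ∧ z ≠ v := by
    have := hux.ne
    exact h.ne_of_adj hxz (by grind) (by grind) (by grind)
  have hab' := h.ne_of_adj hab habS.1 habS.2.1 habS.2.2.1
  have := h.ne_of_adj_of_adj hxz hab hxz' hab' habS.2.2.2
  have hcd' := h.ne_of_adj hcd hcdS.1 hcdS.2.1 hcdS.2.2.1
  have := h.ne_of_adj_of_adj hxz hcd hxz' hcd' hcdS.2.2.2.1
  have := h.ne_of_adj_of_adj hab hcd hab' hcd' hcdS.2.2.2.2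
  have := huv.ne; have := hux.ne; have := hvy.ne; have := hab.ne; have := hcd.ne
  have := hxz.ne
  have := huv.symm; have := hux.symm; have := hvy.symm
  have := hab.symm; have := hcd.symm; have := hxz.symm
  refine ⟨⟨Sum.elim (Sum.elim ![z, x, u, v, y] ![a, b]) ![c, d], ?_⟩,
    map_eq_of_ncard_edgeSet_eq _ ?_ (ncard_edgeSet_pathFour.trans hK.symm)⟩
  · refine (Function.Injective.sumElim ?_ ?_ ?_).sumElim ?_ ?_ <;>
      simp [Function.Injective, Fin.forall_fin_succ] <;> grind
  · simp [Fin.forall_fin_succ, pathGraph_adj, *]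

theorem exists_map_pathFive_eq {V : Type*} [Finite V] {K : SimpleGraph V}
    (hK : K.edgeSet.ncard = 6) {u v x y z w : V} (h : IsFlag K u v x y) (hadj : ¬K.Adj x y)
    (hxz : K.Adj x z) (hzu : z ≠ u) (hyw : K.Adj y w) (hwv : w ≠ v) :
    ∃ f : (Fin 6 ⊕ Fin 2) ↪ V, (pathGraph 6 ⊕g pathGraph 2).map f = K := by
  classical
  obtain ⟨huv, ⟨hux, hxv⟩, ⟨hvy, hyu⟩, hxy, -⟩ := id h
  obtain ⟨a, b, hab, habS⟩ := exists_adj_notMem_of_card_lt (K := K)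
    (S := {s(u, v), s(u, x), s(v, y), s(x, z), s(y, w)})
    (hK ▸ Finset.card_le_five.trans_lt (by simp))
  simp only [Finset.mem_insert, Finset.mem_singleton, not_or] at habS
  have hxz' : (x ≠ u ∧ x ≠ v) ∧ z ≠ u ∧ z ≠ v := by
    have := hux.ne
    exact h.ne_of_adj hxz (by grind) (by grind) (by grind)
  have hyw' : (y ≠ u ∧ y ≠ v) ∧ w ≠ u ∧ w ≠ v := by
    have := hvy.ne
    exact h.ne_of_adj hyw (by grind) (by grind) (by grind)
  have := h.ne_of_adj_of_adj hxz hyw hxz' hyw' (by grind)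
  have hab' := h.ne_of_adj hab habS.1 habS.2.1 habS.2.2.1
  have := h.ne_of_adj_of_adj hxz hab hxz' hab' habS.2.2.2.1
  have := h.ne_of_adj_of_adj hyw hab hyw' hab' habS.2.2.2.2
  have := huv.ne; have := hux.ne; have := hvy.ne; have := hab.ne
  have := hxz.ne; have := hyw.ne
  have := huv.symm; have := hux.symm; have := hvy.symm
  have := hab.symm; have := hxz.symm; have := hyw.symm
  refine ⟨⟨Sum.elim ![z, x, u, v, y, w] ![a, b], ?_⟩,
    map_eq_of_ncard_edgeSet_eq _ ?_ (ncard_edgeSet_pathFive.trans hK.symm)⟩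
  · refine Function.Injective.sumElim ?_ ?_ ?_ <;>
      simp [Function.Injective, Fin.forall_fin_succ] <;> grind
  · simp [Fin.forall_fin_succ, pathGraph_adj, *]

theorem numSubgraphs_eq {V W : Type*} (G : SimpleGraph V) (X : SimpleGraph W)
    (hX : ∀ i, ∃ j, X.Adj i j) :
    numSubgraphs G X = {K : SimpleGraph V | K ≤ G ∧ ∃ f : W ↪ V, X.map f = K}.ncard := by
  have hverts : ∀ H : G.Subgraph, Nonempty (H.coe ≃g X) → ∀ a, a ∈ H.verts ↔ ∃ b, H.Adj a b := by
    rintro H ⟨e⟩ a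
    refine ⟨fun ha => ?_, fun ⟨b, hb⟩ => hb.fst_mem⟩
    obtain ⟨j, hj⟩ := hX (e ⟨a, ha⟩)
    have h : H.coe.Adj ⟨a, ha⟩ (e.symm j) := e.map_rel_iff.1 (by rwa [e.apply_symm_apply])
    exact ⟨e.symm j, h⟩
  have hinj : Set.InjOn Subgraph.spanningCoe {H : G.Subgraph | Nonempty (H.coe ≃g X)} := by
    intro H hH H' hH' h
    have hadj : H.Adj = H'.Adj := Subgraph.spanningCoe_inj.1 h
    exact Subgraph.ext (by ext a; rw [hverts H hH, hverts H' hH', hadj]) hadj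
  rw [numSubgraphs, ← hinj.ncard_image]
  congr 1
  ext K
  constructor
  · rintro ⟨H, ⟨e⟩, rfl⟩
    refine ⟨H.spanningCoe_le, e.symm.toEquiv.toEmbedding.trans (.subtype _), ?_⟩
    ext a b
    simp only [map_adj, Subgraph.spanningCoe_adj]
    constructor
    · rintro ⟨i, j, hij, rfl, rfl⟩
      exact e.symm.map_rel_iff.2 hij
    · intro hab
      exact ⟨e ⟨a, hab.fst_mem⟩, e ⟨b, hab.snd_mem⟩, e.map_rel_iff.2 hab,
        congrArg Subtype.val (e.symm_apply_apply ⟨a, _⟩),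
        congrArg Subtype.val (e.symm_apply_apply ⟨b, _⟩)⟩
  · rintro ⟨hK, f, rfl⟩
    refine ⟨⟨Set.range f, (X.map f).Adj, fun h => hK h, ?_, (X.map f).symm⟩, ⟨?_⟩, ?_⟩
    · rintro a b h
      obtain ⟨i, j, -, rfl, -⟩ := (map_adj ..).1 h
      exact ⟨i, rfl⟩
    · exact RelIso.symm ⟨Equiv.ofInjective f f.injective, fun {i j} =>
        map_adj_apply (G := X) (f := f) (a := i) (b := j)⟩
    · ext a b
      rfl

/-- A graph in which every vertex has at most one neighbour. -/
def IsPartialMatching {V : Type*} (M : SimpleGraph V) : Prop :=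
  ∀ a b c, M.Adj a b → M.Adj a c → b = c

theorem numMatchings_eq {V : Type*} (G : SimpleGraph V) (k : ℕ) :
    numMatchings G k =
      {M : SimpleGraph V | M ≤ G ∧ IsPartialMatching M ∧ M.edgeSet.ncard = k}.ncard := by
  have hinj : Set.InjOn Subgraph.spanningCoe
      {H : G.Subgraph | H.IsMatching ∧ H.edgeSet.ncard = k} := by
    rintro H ⟨hH, -⟩ H' ⟨hH', -⟩ h
    have hadj : H.Adj = H'.Adj := Subgraph.spanningCoe_inj.1 h
    refine Subgraph.ext ?_ hadj
    rw [← hH.support_eq_verts, ← hH'.support_eq_verts]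
    ext a
    simp [Subgraph.mem_support, hadj]
  rw [numMatchings, ← hinj.ncard_image]
  congr 1
  ext K
  constructor
  · rintro ⟨H, ⟨hH, hk⟩, rfl⟩
    exact ⟨H.spanningCoe_le, fun a b c hb hc => (hH hb.fst_mem).unique hb hc, hk⟩
  · rintro ⟨hK, hM, hk⟩
    refine ⟨⟨K.support, K.Adj, fun h => hK h, fun h => ⟨_, h⟩, K.symm⟩, ⟨?_, hk⟩, ?_⟩
    · rintro a ⟨b, hb⟩
      exact ⟨b, hb, fun c hc => hM _ _ _ hc hb⟩
    · ext a b
      rfl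

theorem hasFlag_map_apply {V W : Type*} (κ : Prop → Prop → Prop → Prop) (X : SimpleGraph W)
    (f : W ↪ V) (i j : W) : HasFlag κ (X.map f) (f i) (f j) ↔ HasFlag κ X i j := by
  have hl : ∀ i b, (X.map f).Adj (f i) b ↔ ∃ j, X.Adj i j ∧ f j = b := by
    simp [map_adj]
  have hflag : ∀ x y, IsFlag (X.map f) (f i) (f j) (f x) (f y) ↔ IsFlag X i j x y := by
    intro x y
    have hm : (∀ a, a ≠ f i → a ≠ f j → ∀ b, (X.map f).Adj a b → b ≠ f i → b ≠ f j →
        ∀ c, (X.map f).Adj a c → c ≠ f i → c ≠ f j → b = c) ↔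
        ∀ a, a ≠ i → a ≠ j → ∀ b, X.Adj a b → b ≠ i → b ≠ j →
          ∀ c, X.Adj a c → c ≠ i → c ≠ j → b = c := by
      constructor
      · intro h a hai haj b hb hbi hbj c hc hci hcj
        simpa using h (f a) (by simpa) (by simpa) (f b) (by simpa) (by simpa) (by simpa) (f c)
          (by simpa) (by simpa) (by simpa)
      · intro h a hai haj b hb hbi hbj c hc hci hcj
        obtain ⟨a, b', hb', rfl, rfl⟩ := (map_adj ..).1 hb
        obtain ⟨c', hc', rfl⟩ := (hl ..).1 hc
        rw [f.injective.ne_iff] at hai haj hbi hbj hci hcj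
        exact congrArg f (h a hai haj b' hb' hbi hbj c' hc' hci hcj)
    unfold IsFlag
    rw [hm]
    simp [hl]
  have hex : ∀ (i j : W) (P : V → Prop), (∃ x, ((X.map f).Adj (f i) x ∧ x ≠ f j) ∧ P x) ↔
      ∃ k, (X.Adj i k ∧ k ≠ j) ∧ P (f k) := by
    intro i j P
    constructor
    · rintro ⟨x, ⟨hx, hxj⟩, hP⟩
      obtain ⟨k, hk, rfl⟩ := (hl ..).1 hx
      exact ⟨k, ⟨hk, fun h => hxj (h ▸ rfl)⟩, hP⟩
    · rintro ⟨k, ⟨hk, hkj⟩, hP⟩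
      exact ⟨f k, ⟨(hl ..).2 ⟨k, hk, rfl⟩, f.injective.ne hkj⟩, hP⟩
  have hex' : ∀ i j : W, (∃ x, (X.map f).Adj (f i) x ∧ x ≠ f j) ↔ ∃ k, X.Adj i k ∧ k ≠ j := by
    intro i j
    simp
  simp only [HasFlag, hex, hex', hflag, map_adj_apply]

theorem HasFlag.exists_map_apply_eq {V W : Type*} {κ : Prop → Prop → Prop → Prop}
    {X : SimpleGraph W} {f : W ↪ V} {u v : V} (h : HasFlag κ (X.map f) u v) :
    ∃ i j, f i = u ∧ f j = v := by
  obtain ⟨i, j, -, hi, hj⟩ := (map_adj ..).1 h.1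
  exact ⟨i, j, hi, hj⟩

theorem ncard_setOf_prod {α β : Type*} [Finite α] [Finite β] {A : α → Prop} {R : α → β → Prop}
    {c : ℕ} (h : ∀ a, A a → {b | R a b}.ncard = c) :
    {p : α × β | A p.1 ∧ R p.1 p.2}.ncard = {a | A a}.ncard * c := by
  classical
  have := Fintype.ofFinite α
  have := Fintype.ofFinite β
  simp only [Set.ncard_eq_toFinset_card'] at h ⊢
  rw [Finset.card_eq_sum_card_fiberwise (f := Prod.fst) (t := {a | A a}.toFinset)
    (by intro p hp; simp_all), Finset.sum_const_nat]
  intro a ha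
  have ha : A a := by simpa using ha
  rw [← h a ha, ← Finset.card_map (s := {b | R a b}.toFinset)
    ⟨fun b => (a, b), Prod.mk_right_injective a⟩]
  refine congrArg Finset.card ?_
  ext ⟨a', b⟩
  simp only [Finset.mem_filter, Set.mem_toFinset, Set.mem_ofPred_eq, Finset.mem_map,
    Function.Embedding.coeFn_mk, Prod.mk.injEq]
  grind

theorem numSubgraphs_mul {V W : Type*} [Finite V] (κ : Prop → Prop → Prop → Prop)
    (G : SimpleGraph V) (X : SimpleGraph W) (hX : ∀ i, ∃ j, X.Adj i j) :
    {p : SimpleGraph V × V × V | (p.1 ≤ G ∧ ∃ f : W ↪ V, X.map f = p.1) ∧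
        HasFlag κ p.1 p.2.1 p.2.2}.ncard =
      numSubgraphs G X * {p : W × W | HasFlag κ X p.1 p.2}.ncard := by
  rw [numSubgraphs_eq G X hX]
  refine ncard_setOf_prod (A := fun K => K ≤ G ∧ ∃ f : W ↪ V, X.map f = K)
    (R := fun K (p : V × V) => HasFlag κ K p.1 p.2) ?_
  rintro _ ⟨-, f, rfl⟩
  rw [← Set.ncard_image_of_injective _ (f.injective.prodMap f.injective)]
  congr 1
  ext ⟨u, v⟩
  simp only [Set.mem_ofPred_eq, Set.mem_image, Prod.exists, Prod.map_apply, Prod.mk.injEq]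
  constructor
  · intro h
    obtain ⟨i, j, rfl, rfl⟩ := h.exists_map_apply_eq
    exact ⟨i, j, (hasFlag_map_apply κ X f i j).1 h, rfl, rfl⟩
  · rintro ⟨i, j, h, rfl, rfl⟩
    exact (hasFlag_map_apply κ X f i j).2 h

theorem ncard_setOf_adj {V : Type*} [Finite V] (M : SimpleGraph V) :
    {p : V × V | M.Adj p.1 p.2}.ncard = 2 * M.edgeSet.ncard := by
  classical
  have := Fintype.ofFinite V
  have : {p : V × V | M.Adj p.1 p.2} = Set.range (Dart.toProd : M.Dart → V × V) := by
    ext p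
    exact ⟨fun h => ⟨⟨p, h⟩, rfl⟩, by rintro ⟨d, rfl⟩; exact d.adj⟩
  rw [this, ← Set.image_univ, Set.ncard_image_of_injective _ Dart.toProd_injective,
    Set.ncard_univ, Nat.card_eq_fintype_card, dart_card_eq_twice_card_edges,
    ← coe_edgeFinset, Set.ncard_coe_finset]

theorem ncard_matching_flags {V : Type*} [Fintype V] [DecidableEq V] (G : SimpleGraph V)
    [DecidableRel G.Adj] (hreg : G.IsRegularOfDegree 3) (k : ℕ) :
    {p : SimpleGraph V × (V × V) × V × V |
      (p.1 ≤ G ∧ IsPartialMatching p.1 ∧ p.1.edgeSet.ncard = k) ∧ p.1.Adj p.2.1.1 p.2.1.2 ∧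
        (G.Adj p.2.1.1 p.2.2.1 ∧ p.2.2.1 ≠ p.2.1.2) ∧
        G.Adj p.2.1.2 p.2.2.2 ∧ p.2.2.2 ≠ p.2.1.1}.ncard = numMatchings G k * (2 * k * 4) := by
  rw [numMatchings_eq]
  refine ncard_setOf_prod (A := fun M => M ≤ G ∧ IsPartialMatching M ∧ M.edgeSet.ncard = k)
    (R := fun M (p : (V × V) × V × V) => M.Adj p.1.1 p.1.2 ∧ (G.Adj p.1.1 p.2.1 ∧ p.2.1 ≠ p.1.2) ∧
      G.Adj p.1.2 p.2.2 ∧ p.2.2 ≠ p.1.1) ?_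
  rintro M ⟨hM, -, rfl⟩
  rw [← ncard_setOf_adj]
  refine ncard_setOf_prod (A := fun p : V × V => M.Adj p.1 p.2)
    (R := fun p (q : V × V) => (G.Adj p.1 q.1 ∧ q.1 ≠ p.2) ∧ G.Adj p.2 q.2 ∧ q.2 ≠ p.1) ?_
  rintro ⟨u, v⟩ huv
  have huv : G.Adj u v := hM huv
  have : {q : V × V | (G.Adj u q.1 ∧ q.1 ≠ v) ∧ G.Adj v q.2 ∧ q.2 ≠ u} =
      (((G.neighborFinset u).erase v) ×ˢ ((G.neighborFinset v).erase u) : Finset (V × V)) := by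
    ext q
    simp [and_comm]
  rw [this, Set.ncard_coe_finset, Finset.card_product, Finset.card_erase_of_mem (by simpa),
    Finset.card_erase_of_mem (by simpa using huv.symm), card_neighborFinset_eq_degree,
    card_neighborFinset_eq_degree, hreg u, hreg v]

theorem ncard_edgeSet_sup_edge {V : Type*} [Finite V] {M : SimpleGraph V} {a b : V}
    (h : ¬M.Adj a b) (hab : a ≠ b) : (M ⊔ edge a b).edgeSet.ncard = M.edgeSet.ncard + 1 := by
  classical
  have := Fintype.ofFinite V
  rw [← coe_edgeFinset, Set.ncard_coe_finset, card_edgeFinset_sup_edge _ h hab, ← coe_edgeFinset,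
    Set.ncard_coe_finset]

theorem ncard_matching_flags_eq {V : Type*} [Finite V] (G : SimpleGraph V) (hbip : G.Colorable 2)
    (k : ℕ) :
    {p : SimpleGraph V × (V × V) × V × V |
      (p.1 ≤ G ∧ IsPartialMatching p.1 ∧ p.1.edgeSet.ncard = k) ∧ p.1.Adj p.2.1.1 p.2.1.2 ∧
        (G.Adj p.2.1.1 p.2.2.1 ∧ p.2.2.1 ≠ p.2.1.2) ∧
        G.Adj p.2.1.2 p.2.2.2 ∧ p.2.2.2 ≠ p.2.1.1}.ncard =
    {p : SimpleGraph V × V × V | (p.1 ≤ G ∧ p.1.edgeSet.ncard = k + 2) ∧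
      ∃ x y, IsFlag p.1 p.2.1 p.2.2 x y}.ncard := by
  have hcard : ∀ {M : SimpleGraph V} {u v x y : V}, IsPartialMatching M → M.Adj u v → x ≠ v →
      y ≠ u → u ≠ x → v ≠ y → x ≠ y →
      (M ⊔ edge u x ⊔ edge v y).edgeSet.ncard = M.edgeSet.ncard + 2 := by
    intro M u v x y hM huv hxv hyu hux hvy hxy
    rw [ncard_edgeSet_sup_edge, ncard_edgeSet_sup_edge]
    · exact fun h => hxv (hM _ _ _ h huv)
    · exact hux
    · simp only [sup_adj, edge_adj]
      rintro (h | h)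
      · exact hyu (hM _ _ _ h huv.symm)
      · have := huv.ne
        grind
    · exact hvy
  refine Set.ncard_congr
    (fun p _ => (p.1 ⊔ edge p.2.1.1 p.2.2.1 ⊔ edge p.2.1.2 p.2.2.2, p.2.1)) ?_ ?_ ?_
  · rintro ⟨M, ⟨u, v⟩, x, y⟩ ⟨⟨hMG, hM, hk⟩, huv, ⟨hux, hxv⟩, hvy, hyu⟩
    dsimp only at *
    have hxy : x ≠ y := by
      rintro rfl
      obtain ⟨C⟩ := hbip
      have h1 := C.valid hux
      have h2 := C.valid hvy
      have h3 := C.valid (hMG huv)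
      omega
    refine ⟨⟨sup_le (sup_le hMG ?_) ?_, ?_⟩, x, y, ?_⟩
    · exact (edge_le_iff _).2 (.inr hux)
    · exact (edge_le_iff _).2 (.inr hvy)
    · rw [hcard hM huv hxv hyu hux.ne hvy.ne hxy, hk]
    · have := huv.ne
      have := huv.symm
      have := hux.ne
      have := hvy.ne
      unfold IsPartialMatching at hM
      simp only [IsFlag, sup_adj, edge_adj]
      refine ⟨?_, ?_, ?_, hxy, ?_, ?_, ?_⟩ <;> grind
  · rintro ⟨M, ⟨u, v⟩, x, y⟩ ⟨M', ⟨u', v'⟩, x', y'⟩ ⟨⟨hMG, hM, -⟩, huv, ⟨hux, hxv⟩, hvy, hyu⟩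
      ⟨⟨hMG', hM', -⟩, huv', ⟨hux', hxv'⟩, hvy', hyu'⟩ h
    simp only [Prod.mk.injEq] at h
    obtain ⟨hK, rfl, rfl⟩ := h
    dsimp only at *
    have hK' := fun a b => iff_of_eq (congrArg (fun K : SimpleGraph V => K.Adj a b) hK)
    simp only [sup_adj, edge_adj] at hK'
    unfold IsPartialMatching at hM hM'
    have := huv.ne
    have := huv.symm
    have := huv'.symm
    have := hux.ne
    have := hux'.ne
    have := hvy.ne
    have := hvy'.ne
    obtain rfl : x = x' := by
      have := hK' u x
      grind
    obtain rfl : y = y' := by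
      have := hK' v y
      grind
    obtain rfl : M = M' := by
      ext a b
      have := hK' a b
      grind [SimpleGraph.adj_comm]
    rfl
  · rintro ⟨K, u, v⟩ ⟨⟨hKG, hk⟩, x, y, h⟩
    dsimp only at *
    obtain ⟨huv, ⟨hux, hxv⟩, ⟨hvy, hyu⟩, hxy, hu, hv, hm⟩ := h
    let M : SimpleGraph V :=
      { Adj a b := K.Adj a b ∧
          ((a = u ∧ b = v) ∨ (a = v ∧ b = u) ∨ a ≠ u ∧ a ≠ v ∧ b ≠ u ∧ b ≠ v)
        symm := ⟨fun a b h => ⟨h.1.symm, by grind⟩⟩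
        loopless := ⟨fun a h => h.1.ne rfl⟩ }
    have hMadj : ∀ a b, M.Adj a b ↔ K.Adj a b ∧
      ((a = u ∧ b = v) ∨ (a = v ∧ b = u) ∨ a ≠ u ∧ a ≠ v ∧ b ≠ u ∧ b ≠ v) := fun _ _ => Iff.rfl
    have hMm : IsPartialMatching M := by
      intro a b c
      rw [hMadj, hMadj]
      grind
    have hMuv : M.Adj u v := ⟨huv, .inl ⟨rfl, rfl⟩⟩
    have hK : M ⊔ edge u x ⊔ edge v y = K := by
      ext a b
      have := hux.ne
      have := hvy.ne
      have := huv.symm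
      have := hux.symm
      have := hvy.symm
      have := K.adj_comm a b
      simp only [sup_adj, edge_adj, hMadj]
      grind
    refine ⟨(M, (u, v), x, y), ⟨⟨fun a b h => hKG h.1, hMm, ?_⟩, hMuv, ⟨hKG hux, hxv⟩, hKG hvy, hyu⟩,
      Prod.ext hK rfl⟩
    have := hcard hMm hMuv hxv hyu hux.ne hvy.ne hxy
    rw [hK] at this
    dsimp only
    omega

theorem HasFlag.exists_kinds {V : Type*} {κ κ' : Prop → Prop → Prop → Prop} {K : SimpleGraph V}
    {u v : V} (h : HasFlag κ K u v) (h' : HasFlag κ' K u v) :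
    ∃ r p q : Prop, (r → p ∧ q) ∧ κ r p q ∧ κ' r p q := by
  obtain ⟨-, x, ⟨hux, hxv⟩, y, ⟨hvy, hyu⟩, hf, hκ⟩ := h
  obtain ⟨-, x', ⟨hux', hxv'⟩, y', ⟨hvy', hyu'⟩, -, hκ'⟩ := h'
  obtain ⟨-, -, -, -, hu, hv, -⟩ := hf
  obtain rfl : x' = x := (hu x' hux').resolve_left hxv'
  obtain rfl : y' = y := (hv y' hvy').resolve_left hyu'
  exact ⟨_, _, _, fun h => ⟨⟨_, h, hyu⟩, ⟨_, h.symm, hxv⟩⟩, hκ, hκ'⟩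

theorem ncard_flags_eq {V : Type*} [Finite V] (P : SimpleGraph V → Prop) :
    {p : SimpleGraph V × V × V | P p.1 ∧ ∃ x y, IsFlag p.1 p.2.1 p.2.2 x y}.ncard =
      {p : SimpleGraph V × V × V | P p.1 ∧ HasFlag kindPathThree p.1 p.2.1 p.2.2}.ncard +
      {p : SimpleGraph V × V × V | P p.1 ∧ HasFlag kindCycleFour p.1 p.2.1 p.2.2}.ncard +
      {p : SimpleGraph V × V × V | P p.1 ∧ HasFlag kindPathFour p.1 p.2.1 p.2.2}.ncard +
      {p : SimpleGraph V × V × V | P p.1 ∧ HasFlag kindPathFive p.1 p.2.1 p.2.2}.ncard := by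
  rw [← Set.ncard_union_eq, ← Set.ncard_union_eq, ← Set.ncard_union_eq]
  · congr 1
    ext ⟨K, u, v⟩
    simp only [Set.mem_ofPred_eq, Set.mem_union, ← and_or_left]
    refine and_congr_right fun _ => ⟨?_, ?_⟩
    · rintro ⟨x, y, h⟩
      obtain ⟨huv, hx, hy, -⟩ := id h
      have key : ∀ κ : Prop → Prop → Prop → Prop,
          κ (K.Adj x y) (∃ z, K.Adj x z ∧ z ≠ u) (∃ z, K.Adj y z ∧ z ≠ v) → HasFlag κ K u v :=
        fun κ hκ => ⟨huv, x, hx, y, hy, h, hκ⟩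
      by_cases hr : K.Adj x y
      · exact .inl (.inl (.inr (key kindCycleFour hr)))
      by_cases hp : ∃ z, K.Adj x z ∧ z ≠ u <;> by_cases hq : ∃ z, K.Adj y z ∧ z ≠ v
      · exact .inr (key kindPathFive ⟨hr, hp, hq⟩)
      · exact .inl (.inr (key kindPathFour ⟨fun h => hq h.2, .inl hp⟩))
      · exact .inl (.inr (key kindPathFour ⟨fun h => hp h.1, .inr hq⟩))
      · exact .inl (.inl (.inl (key kindPathThree ⟨hp, hq⟩)))
    · rintro (((h | h) | h) | h) <;>
      · obtain ⟨-, x, -, y, -, h, -⟩ := h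
        exact ⟨x, y, h⟩
  all_goals
    rw [Set.disjoint_left]
    rintro ⟨K, u, v⟩ h ⟨-, h'⟩
    simp only [Set.mem_union, Set.mem_ofPred_eq, ← and_or_left] at h h'
    obtain ⟨-, h⟩ := h
    first
      | obtain (h | h) | h := h
      | obtain h | h := h
      | skip
    all_goals
      obtain ⟨r, p, q, hr, h1, h2⟩ := h.exists_kinds h'
      grind

theorem numSubgraphs_mul_of_exists_map {V W : Type*} [Finite V] {κ : Prop → Prop → Prop → Prop}
    (G : SimpleGraph V) {X : SimpleGraph W} (hX : ∀ i, ∃ j, X.Adj i j) {m : ℕ}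
    (hm : X.edgeSet.ncard = m)
    (h : ∀ (K : SimpleGraph V) (u v : V), K.edgeSet.ncard = m → HasFlag κ K u v →
      ∃ f : W ↪ V, X.map f = K) :
    {p : SimpleGraph V × V × V | (p.1 ≤ G ∧ p.1.edgeSet.ncard = m) ∧
        HasFlag κ p.1 p.2.1 p.2.2}.ncard =
      numSubgraphs G X * {p : W × W | HasFlag κ X p.1 p.2}.ncard := by
  rw [← numSubgraphs_mul κ G X hX]
  congr 1
  ext ⟨K, u, v⟩
  constructor
  · rintro ⟨⟨hK, hm⟩, hf⟩
    exact ⟨⟨hK, h K u v hm hf⟩, hf⟩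
  · rintro ⟨⟨hK, f, rfl⟩, hf⟩
    refine ⟨⟨hK, ?_⟩, hf⟩
    rw [edgeSet_map, Set.ncard_image_of_injective _ (Function.Embedding.injective _), hm]

set_option synthInstance.maxSize 1000 in
set_option synthInstance.maxHeartbeats 200000 in
theorem ncard_hasFlag_pathThree :
    {p : _ × _ | HasFlag kindPathThree (pathGraph 4 ⊕g pathGraph 2 ⊕g pathGraph 2 ⊕g pathGraph 2)
      p.1 p.2}.ncard = 2 := by
  rw [Set.ncard_eq_toFinset_card']
  decide +kernel

theorem ncard_hasFlag_cycleFour :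
    {p : _ × _ | HasFlag kindCycleFour (cycleGraph 4 ⊕g pathGraph 2 ⊕g pathGraph 2)
      p.1 p.2}.ncard = 8 := by
  rw [Set.ncard_eq_toFinset_card']
  decide +kernel

theorem ncard_hasFlag_pathFour :
    {p : _ × _ | HasFlag kindPathFour (pathGraph 5 ⊕g pathGraph 2 ⊕g pathGraph 2)
      p.1 p.2}.ncard = 4 := by
  rw [Set.ncard_eq_toFinset_card']
  decide +kernel

theorem ncard_hasFlag_pathFive :
    {p : _ × _ | HasFlag kindPathFive (pathGraph 6 ⊕g pathGraph 2) p.1 p.2}.ncard = 2 := by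
  rw [Set.ncard_eq_toFinset_card']
  decide +kernel

theorem stmt_2 {V : Type*} [Fintype V] [DecidableEq V] (G : SimpleGraph V) [DecidableRel G.Adj]
    (hreg : G.IsRegularOfDegree 3) (hbip : G.Colorable 2) :
    16 * numMatchings G 4 =
      numSubgraphs G (pathGraph 4 ⊕g pathGraph 2 ⊕g pathGraph 2 ⊕g pathGraph 2) + 4 * numSubgraphs G (cycleGraph 4 ⊕g pathGraph 2 ⊕g pathGraph 2)
        + 2 * numSubgraphs G (pathGraph 5 ⊕g pathGraph 2 ⊕g pathGraph 2) + numSubgraphs G (pathGraph 6 ⊕g pathGraph 2) := by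
  have h3 := numSubgraphs_mul_of_exists_map (κ := kindPathThree) G
    (X := pathGraph 4 ⊕g pathGraph 2 ⊕g pathGraph 2 ⊕g pathGraph 2) (by decide +kernel)
    ncard_edgeSet_pathThree (by
      rintro K u v hK ⟨-, x, -, y, -, hf, hx, hy⟩
      push Not at hx hy
      exact exists_map_pathThree_eq hK hf hx hy)
  have hC := numSubgraphs_mul_of_exists_map (κ := kindCycleFour) G
    (X := cycleGraph 4 ⊕g pathGraph 2 ⊕g pathGraph 2) (by decide +kernel)
    ncard_edgeSet_cycleFour (by
      rintro K u v hK ⟨-, x, -, y, -, hf, hxy⟩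
      exact exists_map_cycleFour_eq hK hf hxy)
  have h4 := numSubgraphs_mul_of_exists_map (κ := kindPathFour) G
    (X := pathGraph 5 ⊕g pathGraph 2 ⊕g pathGraph 2) (by decide +kernel)
    ncard_edgeSet_pathFour (by
      rintro K u v hK ⟨-, x, -, y, -, hf, hne, ⟨z, hz, hzu⟩ | ⟨z, hz, hzv⟩⟩
      · have hy : ∀ w, K.Adj y w → w = v := by
          by_contra! hw
          exact hne ⟨⟨z, hz, hzu⟩, hw⟩
        exact exists_map_pathFour_eq hK hf hz hzu hy
      · have hx : ∀ w, K.Adj x w → w = u := by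
          by_contra! hw
          exact hne ⟨hw, ⟨z, hz, hzv⟩⟩
        exact exists_map_pathFour_eq hK hf.symm hz hzv hx)
  have h5 := numSubgraphs_mul_of_exists_map (κ := kindPathFive) G
    (X := pathGraph 6 ⊕g pathGraph 2) (by decide +kernel)
    ncard_edgeSet_pathFive (by
      rintro K u v hK ⟨-, x, -, y, -, hf, hxy, ⟨z, hz, hzu⟩, w, hw, hwv⟩
      exact exists_map_pathFive_eq hK hf hxy hz hzu hw hwv)
  rw [ncard_hasFlag_pathThree] at h3
  rw [ncard_hasFlag_cycleFour] at hC
  rw [ncard_hasFlag_pathFour] at h4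
  rw [ncard_hasFlag_pathFive] at h5
  have hM := ncard_matching_flags G hreg 4
  rw [ncard_matching_flags_eq G hbip 4,
    ncard_flags_eq (fun K : SimpleGraph V => K ≤ G ∧ K.edgeSet.ncard = 6), h3, hC, h4, h5] at hM
  omega
end

section
/- Let G be a finite simple 3-regular bipartite graph with m edges. Then M(G,4)·(m−4) = 5·M(G,5) + 2·N(P₂+3K₂) + N(P₃+2K₂). -/
open SimpleGraph

/-- A finite set of edges is a matching if distinct edges share no vertex. -/
abbrev PairwiseDisjointEdges {W : Type*} (S : Finset (Sym2 W)) : Prop :=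
  ∀ e ∈ S, ∀ f ∈ S, e ≠ f → ∀ v, ¬ (v ∈ e ∧ v ∈ f)

/-- The edges of `S` whose removal leaves a matching. -/
def matchingDeletions {W : Type*} [Fintype W] [DecidableEq W] (S : Finset (Sym2 W)) :
    Finset (Sym2 W) :=
  S.filter fun e => PairwiseDisjointEdges (S.erase e)

theorem pairwiseDisjointEdges_map {W V : Type*} (f : W ↪ V) (S : Finset (Sym2 W)) :
    PairwiseDisjointEdges (S.map f.sym2Map) ↔ PairwiseDisjointEdges S := by
  constructor
  · intro h e he e' he' hne v ⟨hv, hv'⟩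
    refine h _ (Finset.mem_map_of_mem _ he) _ (Finset.mem_map_of_mem _ he')
      (fun h => hne (f.sym2Map.injective h)) (f v) ⟨?_, ?_⟩
    · exact Sym2.mem_map.2 ⟨v, hv, rfl⟩
    · exact Sym2.mem_map.2 ⟨v, hv', rfl⟩
  · intro h e he e' he' hne v ⟨hv, hv'⟩
    obtain ⟨d, hd, rfl⟩ := Finset.mem_map.1 he
    obtain ⟨d', hd', rfl⟩ := Finset.mem_map.1 he'
    obtain ⟨x, hx, rfl⟩ := Sym2.mem_map.1 hv
    obtain ⟨y, hy, hxy⟩ := Sym2.mem_map.1 hv'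
    obtain rfl := f.injective hxy
    exact h d hd d' hd' (fun h => hne (h ▸ rfl)) y ⟨hx, hy⟩

theorem matchingDeletions_map {W V : Type*} [Fintype W] [DecidableEq W] [Fintype V]
    [DecidableEq V] (f : W ↪ V) (S : Finset (Sym2 W)) :
    matchingDeletions (S.map f.sym2Map) = (matchingDeletions S).map f.sym2Map := by
  unfold matchingDeletions
  rw [Finset.filter_map]
  congr 1
  refine Finset.filter_congr fun e _ => ?_
  rw [Function.comp_apply, ← Finset.map_erase, pairwiseDisjointEdges_map]

/-- The subgraph of `G` formed by the edges in `S` and their endpoints. -/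
def subgraphOfEdges {V : Type*} (G : SimpleGraph V) (S : Finset (Sym2 V)) : G.Subgraph where
  verts := {v | ∃ w, G.Adj v w ∧ s(v, w) ∈ S}
  Adj v w := G.Adj v w ∧ s(v, w) ∈ S
  adj_sub h := h.1
  edge_vert h := ⟨_, h⟩
  symm := ⟨fun _ _ h => ⟨h.1.symm, Sym2.eq_swap ▸ h.2⟩⟩

theorem edgeSet_subgraphOfEdges {V : Type*} (G : SimpleGraph V) {S : Finset (Sym2 V)}
    (hS : (S : Set (Sym2 V)) ⊆ G.edgeSet) : (subgraphOfEdges G S).edgeSet = S := by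
  ext e
  induction e with | _ v w
  exact ⟨fun h => h.2, fun h => ⟨hS h, h⟩⟩

theorem ncard_subgraphs_eq_card {V : Type*} [Fintype V] [DecidableEq V] (G : SimpleGraph V)
    (P : G.Subgraph → Prop) (hP : ∀ H, P H → ∀ v ∈ H.verts, ∃ w, H.Adj v w)
    (T : Finset (Finset (Sym2 V)))
    (hT : ∀ S, S ∈ T ↔ (S : Set (Sym2 V)) ⊆ G.edgeSet ∧ P (subgraphOfEdges G S)) :
    {H | P H}.ncard = T.card := by
  classical
  have himage : {H | P H} = subgraphOfEdges G '' (T : Set (Finset (Sym2 V))) := by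
    ext H
    constructor
    · intro hH
      have heq : subgraphOfEdges G H.edgeSet.toFinite.toFinset = H := by
        refine Subgraph.ext ?_ ?_
        · ext v
          simp only [subgraphOfEdges, Set.mem_ofPred_eq, Set.Finite.mem_toFinset,
            Subgraph.mem_edgeSet]
          exact ⟨fun ⟨w, _, h⟩ => H.edge_vert h, fun hv =>
            (hP H hH v hv).imp fun w h => ⟨h.adj_sub, h⟩⟩
        · ext v w
          simp only [subgraphOfEdges, Set.Finite.mem_toFinset, Subgraph.mem_edgeSet]
          exact ⟨fun h => h.2, fun h => ⟨h.adj_sub, h⟩⟩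
      refine ⟨_, (hT _).2 ⟨?_, ?_⟩, heq⟩
      · rw [Set.Finite.coe_toFinset]
        exact H.edgeSet_subset
      · rw [heq]
        exact hH
    · rintro ⟨S, hS, rfl⟩
      exact ((hT S).1 hS).2
  rw [himage, Set.InjOn.ncard_image, Set.ncard_coe_finset]
  intro S hS S' hS' h
  have := congrArg Subgraph.edgeSet h
  rw [edgeSet_subgraphOfEdges G ((hT S).1 hS).1,
    edgeSet_subgraphOfEdges G ((hT S').1 hS').1] at this
  exact_mod_cast this

theorem isMatching_subgraphOfEdges_iff {V : Type*} (G : SimpleGraph V) {S : Finset (Sym2 V)}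
    (hS : (S : Set (Sym2 V)) ⊆ G.edgeSet) :
    (subgraphOfEdges G S).IsMatching ↔ PairwiseDisjointEdges S := by
  constructor
  · intro h e he f hf hne v ⟨hve, hvf⟩
    obtain ⟨a, rfl⟩ := hve
    obtain ⟨b, rfl⟩ := hvf
    exact hne (by rw [(h ⟨a, hS he, he⟩).unique (y₁ := a) (y₂ := b) ⟨hS he, he⟩ ⟨hS hf, hf⟩])
  · rintro h v ⟨w, hw⟩
    refine ⟨w, hw, fun u hu => ?_⟩
    by_contra hne
    refine h _ hu.2 _ hw.2 (fun h => hne ?_) v ⟨Sym2.mem_mk_left _ _, Sym2.mem_mk_left _ _⟩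
    exact Sym2.congr_right.1 h

theorem numMatchings_eq_card {V : Type*} [Fintype V] [DecidableEq V] (G : SimpleGraph V)
    [DecidableRel G.Adj] (k : ℕ) :
    numMatchings G k = ((G.edgeFinset.powersetCard k).filter PairwiseDisjointEdges).card := by
  refine ncard_subgraphs_eq_card G _ (fun H hH v hv => (hH.1 hv).exists) _ fun S => ?_
  rw [Finset.mem_filter, Finset.mem_powersetCard, ← Finset.coe_subset, coe_edgeFinset, and_assoc]
  refine and_congr_right fun hS => ?_
  rw [isMatching_subgraphOfEdges_iff G hS, edgeSet_subgraphOfEdges G hS, Set.ncard_coe_finset,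
    and_comm]

theorem nonempty_iso_subgraphOfEdges_iff {V W : Type*} (G : SimpleGraph V) {S : Finset (Sym2 V)}
    (hS : (S : Set (Sym2 V)) ⊆ G.edgeSet) (X : SimpleGraph W) (hX : ∀ a, ∃ b, X.Adj a b)
    (E : Finset (Sym2 W)) (hE : ∀ a b, s(a, b) ∈ E ↔ X.Adj a b) :
    Nonempty ((subgraphOfEdges G S).coe ≃g X) ↔ ∃ f : W ↪ V, S = E.map f.sym2Map := by
  constructor
  · rintro ⟨φ⟩
    refine ⟨φ.symm.toEquiv.toEmbedding.trans (Function.Embedding.subtype _), ?_⟩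
    ext e
    rw [Finset.mem_map]
    constructor
    · intro he
      induction e with | _ v w
      have hv : v ∈ (subgraphOfEdges G S).verts := ⟨w, hS he, he⟩
      have hvw : (subgraphOfEdges G S).Adj v w := ⟨hS he, he⟩
      refine ⟨s(φ ⟨v, hv⟩, φ ⟨w, hvw.symm.fst_mem⟩), (hE _ _).2 (φ.map_rel_iff.2 hvw), ?_⟩
      simp [Function.Embedding.sym2Map]
    · rintro ⟨d, hd, rfl⟩
      induction d with | _ a b
      exact (φ.symm.map_rel_iff.2 ((hE a b).1 hd)).2
  · rintro ⟨f, rfl⟩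
    have hadj (a b : W) : s(f a, f b) ∈ E.map f.sym2Map ↔ X.Adj a b := by
      rw [← hE, ← Finset.mem_map' f.sym2Map]
      rfl
    have hverts (v : V) : v ∈ (subgraphOfEdges G (E.map f.sym2Map)).verts ↔ v ∈ Set.range f := by
      constructor
      · rintro ⟨w, _, h⟩
        obtain ⟨d, _, hd⟩ := Finset.mem_map.1 h
        have : v ∈ d.map f := by
          change v ∈ f.sym2Map d
          rw [hd]
          exact Sym2.mem_mk_left _ _
        obtain ⟨a, _, ha⟩ := Sym2.mem_map.1 this
        exact ⟨a, ha⟩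
      · rintro ⟨a, rfl⟩
        obtain ⟨b, hb⟩ := hX a
        exact ⟨f b, hS ((hadj a b).2 hb), (hadj a b).2 hb⟩
    refine ⟨RelIso.symm ⟨(Equiv.ofInjective f f.injective).trans
      (Equiv.subtypeEquivRight fun v => (hverts v).symm), ?_⟩⟩
    intro a b
    exact ⟨fun h => (hadj a b).1 h.2, fun h => ⟨hS ((hadj a b).2 h), (hadj a b).2 h⟩⟩

theorem numSubgraphs_eq_card {V W : Type*} [Fintype V] [DecidableEq V] (G : SimpleGraph V)
    [DecidableRel G.Adj] (X : SimpleGraph W) (hX : ∀ a, ∃ b, X.Adj a b)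
    (E : Finset (Sym2 W)) (hE : ∀ a b, s(a, b) ∈ E ↔ X.Adj a b)
    [DecidablePred fun S : Finset (Sym2 V) => ∃ f : W ↪ V, S = E.map f.sym2Map] :
    numSubgraphs G X = ((G.edgeFinset.powersetCard E.card).filter
      fun S => ∃ f : W ↪ V, S = E.map f.sym2Map).card := by
  refine ncard_subgraphs_eq_card G _ ?_ _ fun S => ?_
  · rintro H ⟨φ⟩ v hv
    obtain ⟨b, hb⟩ := hX (φ ⟨v, hv⟩)
    refine ⟨φ.symm b, ?_⟩
    have := φ.symm.map_rel_iff.2 hb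
    rw [φ.symm_apply_apply] at this
    exact this
  rw [Finset.mem_filter, Finset.mem_powersetCard, ← Finset.coe_subset, coe_edgeFinset, and_assoc]
  refine and_congr_right fun hS => ?_
  rw [nonempty_iso_subgraphOfEdges_iff G hS X hX E hE, and_iff_right_of_imp]
  rintro ⟨f, rfl⟩
  exact Finset.card_map _

theorem sum_card_matchingDeletions {V : Type*} [Fintype V] [DecidableEq V]
    (E : Finset (Sym2 V)) (k : ℕ) :
    ∑ S ∈ E.powersetCard (k + 1), (matchingDeletions S).card =
      ((E.powersetCard k).filter PairwiseDisjointEdges).card * (E.card - k) := by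
  have hsum : ((E.powersetCard k).filter PairwiseDisjointEdges).card * (E.card - k) =
      ∑ M ∈ (E.powersetCard k).filter PairwiseDisjointEdges, (E \ M).card := by
    rw [Finset.sum_const_nat]
    intro M hM
    obtain ⟨hME, hMk⟩ := Finset.mem_powersetCard.1 (Finset.mem_filter.1 hM).1
    rw [Finset.card_sdiff_of_subset hME, hMk]
  rw [hsum, ← Finset.card_sigma, ← Finset.card_sigma]
  refine Finset.card_bij' (fun p _ => ⟨p.1.erase p.2, p.2⟩) (fun p _ => ⟨insert p.2 p.1, p.2⟩)
    ?_ ?_ ?_ ?_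
  · rintro ⟨S, e⟩ h
    simp only [Finset.mem_sigma, Finset.mem_powersetCard, matchingDeletions,
      Finset.mem_filter, Finset.mem_sdiff] at h ⊢
    obtain ⟨⟨hS, hk⟩, he, hM⟩ := h
    refine ⟨⟨⟨(Finset.erase_subset _ _).trans hS, ?_⟩, hM⟩, hS he, Finset.notMem_erase _ _⟩
    rw [Finset.card_erase_of_mem he, hk, Nat.add_sub_cancel]
  · rintro ⟨M, e⟩ h
    simp only [Finset.mem_sigma, Finset.mem_powersetCard, matchingDeletions,
      Finset.mem_filter, Finset.mem_sdiff] at h ⊢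
    obtain ⟨⟨⟨hS, hk⟩, hM⟩, he, heM⟩ := h
    refine ⟨⟨Finset.insert_subset he hS, ?_⟩, Finset.mem_insert_self _ _, ?_⟩
    · rw [Finset.card_insert_of_notMem heM, hk]
    · rwa [Finset.erase_insert heM]
  · rintro ⟨S, e⟩ h
    simp only [Finset.mem_sigma, matchingDeletions, Finset.mem_filter] at h
    simp [Finset.insert_erase h.2.1]
  · rintro ⟨M, e⟩ h
    simp only [Finset.mem_sigma, Finset.mem_sdiff] at h
    simp [Finset.erase_insert h.2.2]

/-- The edges of `P₂ + 3K₂`. -/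
def edgesPathThree : Finset (Sym2 (((Fin 3 ⊕ Fin 2) ⊕ Fin 2) ⊕ Fin 2)) :=
  {s(.inl (.inl (.inl 0)), .inl (.inl (.inl 1))), s(.inl (.inl (.inl 1)), .inl (.inl (.inl 2))),
    s(.inl (.inl (.inr 0)), .inl (.inl (.inr 1))), s(.inl (.inr 0), .inl (.inr 1)),
    s(.inr 0, .inr 1)}

/-- The edges of `P₃ + 2K₂`. -/
def edgesPathFour : Finset (Sym2 ((Fin 4 ⊕ Fin 2) ⊕ Fin 2)) :=
  {s(.inl (.inl 0), .inl (.inl 1)), s(.inl (.inl 1), .inl (.inl 2)),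
    s(.inl (.inl 2), .inl (.inl 3)), s(.inl (.inr 0), .inl (.inr 1)), s(.inr 0, .inr 1)}

theorem mem_edgesPathThree (a b : ((Fin 3 ⊕ Fin 2) ⊕ Fin 2) ⊕ Fin 2) :
    s(a, b) ∈ edgesPathThree ↔
      (pathGraph 3 ⊕g pathGraph 2 ⊕g pathGraph 2 ⊕g pathGraph 2).Adj a b := by
  rcases a with ((a | a) | a) | a <;> rcases b with ((b | b) | b) | b <;>
    simp only [SimpleGraph.sum_adj, pathGraph_adj] <;> decide +revert

theorem mem_edgesPathFour (a b : (Fin 4 ⊕ Fin 2) ⊕ Fin 2) :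
    s(a, b) ∈ edgesPathFour ↔ (pathGraph 4 ⊕g pathGraph 2 ⊕g pathGraph 2).Adj a b := by
  rcases a with (a | a) | a <;> rcases b with (b | b) | b <;>
    simp only [SimpleGraph.sum_adj, pathGraph_adj] <;> decide +revert

theorem card_matchingDeletions_edgesPathThree : (matchingDeletions edgesPathThree).card = 2 := by
  decide +kernel

theorem card_matchingDeletions_edgesPathFour : (matchingDeletions edgesPathFour).card = 1 := by
  decide +kernel

theorem exists_map_edgesPathThree_eq {V : Type*} [DecidableEq V] {a b c d e f g h i : V}
    (hnodup : [a, b, c, d, e, f, g, h, i].Nodup) :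
    ∃ φ : ((Fin 3 ⊕ Fin 2) ⊕ Fin 2) ⊕ Fin 2 ↪ V,
      {s(a, b), s(b, c), s(d, e), s(f, g), s(h, i)} = edgesPathThree.map φ.sym2Map := by
  refine ⟨⟨Sum.elim (Sum.elim (Sum.elim ![a, b, c] ![d, e]) ![f, g]) ![h, i], ?_⟩, ?_⟩
  · simp only [List.nodup_cons, List.mem_cons, not_or, List.not_mem_nil] at hnodup
    rintro (((x | x) | x) | x) (((y | y) | y) | y) hxy <;> fin_cases x <;> fin_cases y <;>
      simp at hxy ⊢ <;> grind
  · simp [edgesPathThree, Function.Embedding.sym2Map, DFunLike.coe]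

theorem exists_map_edgesPathFour_eq {V : Type*} [DecidableEq V] {a b c d e f g h : V}
    (hnodup : [a, b, c, d, e, f, g, h].Nodup) :
    ∃ φ : (Fin 4 ⊕ Fin 2) ⊕ Fin 2 ↪ V,
      {s(a, b), s(b, c), s(c, d), s(e, f), s(g, h)} = edgesPathFour.map φ.sym2Map := by
  refine ⟨⟨Sum.elim (Sum.elim ![a, b, c, d] ![e, f]) ![g, h], ?_⟩, ?_⟩
  · simp only [List.nodup_cons, List.mem_cons, not_or, List.not_mem_nil] at hnodup
    rintro ((x | x) | x) ((y | y) | y) hxy <;> fin_cases x <;> fin_cases y <;>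
      simp at hxy ⊢ <;> grind
  · simp [edgesPathFour, Function.Embedding.sym2Map, DFunLike.coe]

theorem exists_map_eq_insert_of_mem {V : Type*} [DecidableEq V] {M : Finset (Sym2 V)}
    (hM : PairwiseDisjointEdges M) (hcard : M.card = 4) (hdiag : ∀ e ∈ M, ¬ e.IsDiag)
    {p q : V} (hpq : p ≠ q) (hmem : s(p, q) ∉ M) {f : Sym2 V} (hf : f ∈ M) (hpf : p ∈ f) :
    (∃ φ : ((Fin 3 ⊕ Fin 2) ⊕ Fin 2) ⊕ Fin 2 ↪ V,
      insert s(p, q) M = edgesPathThree.map φ.sym2Map) ∨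
    ∃ φ : (Fin 4 ⊕ Fin 2) ⊕ Fin 2 ↪ V, insert s(p, q) M = edgesPathFour.map φ.sym2Map := by
  obtain ⟨b, rfl⟩ := hpf
  by_cases hq : ∃ g ∈ M, q ∈ g
  · right
    obtain ⟨g, hg, c, rfl⟩ := hq
    have hne : s(q, c) ≠ s(p, b) := by
      intro h
      rw [Sym2.eq_iff] at h
      rcases h with ⟨h, -⟩ | ⟨rfl, rfl⟩
      · exact hpq h.symm
      · exact hmem hf
    have hcard' : ((M.erase s(p, b)).erase s(q, c)).card = 2 := by
      rw [Finset.card_erase_of_mem (Finset.mem_erase.2 ⟨hne, hg⟩), Finset.card_erase_of_mem hf,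
        hcard]
    obtain ⟨h, k, hhk, hE⟩ := Finset.card_eq_two.1 hcard'
    have hMeq : M = {s(p, b), s(q, c), h, k} := by
      rw [← hE, Finset.insert_erase (Finset.mem_erase.2 ⟨hne, hg⟩), Finset.insert_erase hf]
    have hh : h ∈ (M.erase s(p, b)).erase s(q, c) := by simp [hE]
    have hk : k ∈ (M.erase s(p, b)).erase s(q, c) := by simp [hE]
    simp only [Finset.mem_erase] at hh hk
    induction h with | _ h₁ h₂
    induction k with | _ k₁ k₂
    have hnodup : [b, p, q, c, h₁, h₂, k₁, k₂].Nodup := by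
      have d₁ := hdiag _ hf
      have d₂ := hdiag _ hg
      have d₃ := hdiag _ hh.2.2
      have d₄ := hdiag _ hk.2.2
      have m₁ := hM _ hf _ hg hne.symm
      have m₂ := hM _ hh.2.2 _ hf hh.2.1
      have m₃ := hM _ hh.2.2 _ hg hh.1
      have m₄ := hM _ hk.2.2 _ hf hk.2.1
      have m₅ := hM _ hk.2.2 _ hg hk.1
      have m₆ := hM _ hh.2.2 _ hk.2.2 hhk
      clear hM hdiag hcard hcard' hMeq hE hmem
      simp only [Sym2.mem_iff, Sym2.mk_isDiag_iff, not_and, forall_eq_or_imp, forall_eq,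
        not_or] at *
      simp only [List.nodup_cons, List.mem_cons, not_or, List.not_mem_nil, List.nodup_nil]
      grind
    obtain ⟨φ, hφ⟩ := exists_map_edgesPathFour_eq hnodup
    refine ⟨φ, ?_⟩
    rw [← hφ, hMeq, Sym2.eq_swap (a := b), Finset.insert_comm]
  · left
    have hcard' : (M.erase s(p, b)).card = 3 := by
      rw [Finset.card_erase_of_mem hf, hcard]
    obtain ⟨g, h, k, hgh, hgk, hhk, hE⟩ := Finset.card_eq_three.1 hcard'
    have hMeq : M = {s(p, b), g, h, k} := by
      rw [← hE, Finset.insert_erase hf]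
    have hg : g ∈ M.erase s(p, b) := by simp [hE]
    have hh : h ∈ M.erase s(p, b) := by simp [hE]
    have hk : k ∈ M.erase s(p, b) := by simp [hE]
    simp only [Finset.mem_erase] at hg hh hk
    push Not at hq
    induction g with | _ g₁ g₂
    induction h with | _ h₁ h₂
    induction k with | _ k₁ k₂
    have hnodup : [b, p, q, g₁, g₂, h₁, h₂, k₁, k₂].Nodup := by
      have d₁ := hdiag _ hf
      have d₂ := hdiag _ hg.2
      have d₃ := hdiag _ hh.2
      have d₄ := hdiag _ hk.2
      have q₁ := hq _ hf
      have q₂ := hq _ hg.2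
      have q₃ := hq _ hh.2
      have q₄ := hq _ hk.2
      have m₁ := hM _ hg.2 _ hf hg.1
      have m₂ := hM _ hh.2 _ hf hh.1
      have m₃ := hM _ hk.2 _ hf hk.1
      have m₄ := hM _ hg.2 _ hh.2 hgh
      have m₅ := hM _ hg.2 _ hk.2 hgk
      have m₆ := hM _ hh.2 _ hk.2 hhk
      clear hM hdiag hcard hcard' hMeq hE hmem
      simp only [Sym2.mem_iff, Sym2.mk_isDiag_iff, not_and, forall_eq_or_imp, forall_eq,
        not_or] at *
      simp only [List.nodup_cons, List.mem_cons, not_or, List.not_mem_nil, List.nodup_nil]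
      grind
    obtain ⟨φ, hφ⟩ := exists_map_edgesPathThree_eq hnodup
    refine ⟨φ, ?_⟩
    rw [← hφ, hMeq, Sym2.eq_swap (a := b), Finset.insert_comm]

theorem exists_map_eq_of_mem_matchingDeletions {V : Type*} [Fintype V] [DecidableEq V]
    {S : Finset (Sym2 V)} (hcard : S.card = 5) (hdiag : ∀ e ∈ S, ¬ e.IsDiag)
    (hS : ¬ PairwiseDisjointEdges S) {e : Sym2 V} (he : e ∈ matchingDeletions S) :
    (∃ φ : ((Fin 3 ⊕ Fin 2) ⊕ Fin 2) ⊕ Fin 2 ↪ V, S = edgesPathThree.map φ.sym2Map) ∨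
    ∃ φ : (Fin 4 ⊕ Fin 2) ⊕ Fin 2 ↪ V, S = edgesPathFour.map φ.sym2Map := by
  obtain ⟨heS, hM⟩ := Finset.mem_filter.1 he
  have hmeet : ∃ f ∈ S.erase e, ∃ v ∈ f, v ∈ e := by
    by_contra! hcon
    refine hS fun f hf g hg hne v ⟨hvf, hvg⟩ => ?_
    by_cases hfe : f = e
    · exact hcon g (Finset.mem_erase.2 ⟨fun h => hne (hfe.trans h.symm), hg⟩) v hvg (hfe ▸ hvf)
    by_cases hge : g = e
    · exact hcon f (Finset.mem_erase.2 ⟨hfe, hf⟩) v hvf (hge ▸ hvg)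
    exact hM f (Finset.mem_erase.2 ⟨hfe, hf⟩) g (Finset.mem_erase.2 ⟨hge, hg⟩) hne v ⟨hvf, hvg⟩
  obtain ⟨f, hf, p, hpf, q, rfl⟩ := hmeet
  rw [← Finset.insert_erase heS]
  refine exists_map_eq_insert_of_mem hM ?_ (fun e h => hdiag e (Finset.mem_of_mem_erase h))
    (fun h => hdiag _ heS (Sym2.mk_isDiag_iff.2 h)) (Finset.notMem_erase _ _) hf hpf
  rw [Finset.card_erase_of_mem heS, hcard]

theorem matchingDeletions_eq_self {V : Type*} [Fintype V] [DecidableEq V]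
    {S : Finset (Sym2 V)} (hS : PairwiseDisjointEdges S) : matchingDeletions S = S :=
  Finset.filter_true_of_mem fun _ _ f hf g hg =>
    hS f (Finset.mem_of_mem_erase hf) g (Finset.mem_of_mem_erase hg)

open Classical in
theorem card_matchingDeletions_eq {V : Type*} [Fintype V] [DecidableEq V]
    {S : Finset (Sym2 V)} (hcard : S.card = 5) (hdiag : ∀ e ∈ S, ¬ e.IsDiag) :
    (matchingDeletions S).card = 5 * (if PairwiseDisjointEdges S then 1 else 0) +
      2 * (if ∃ φ : ((Fin 3 ⊕ Fin 2) ⊕ Fin 2) ⊕ Fin 2 ↪ V,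
        S = edgesPathThree.map φ.sym2Map then 1 else 0) +
      (if ∃ φ : (Fin 4 ⊕ Fin 2) ⊕ Fin 2 ↪ V, S = edgesPathFour.map φ.sym2Map then 1 else 0) := by
  have hmatching : PairwiseDisjointEdges S → (matchingDeletions S).card = 5 := fun h => by
    rw [matchingDeletions_eq_self h, hcard]
  have hthree : (∃ φ : ((Fin 3 ⊕ Fin 2) ⊕ Fin 2) ⊕ Fin 2 ↪ V,
      S = edgesPathThree.map φ.sym2Map) → (matchingDeletions S).card = 2 := by
    rintro ⟨φ, rfl⟩
    rw [matchingDeletions_map, Finset.card_map, card_matchingDeletions_edgesPathThree]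
  have hfour : (∃ φ : (Fin 4 ⊕ Fin 2) ⊕ Fin 2 ↪ V,
      S = edgesPathFour.map φ.sym2Map) → (matchingDeletions S).card = 1 := by
    rintro ⟨φ, rfl⟩
    rw [matchingDeletions_map, Finset.card_map, card_matchingDeletions_edgesPathFour]
  have hzero (h : ¬ PairwiseDisjointEdges S) (h0 : (matchingDeletions S).card ≠ 0) :=
    (Finset.card_ne_zero.1 h0).elim fun _ he =>
      exists_map_eq_of_mem_matchingDeletions hcard hdiag h he
  split_ifs with h₁ h₂ h₃ h₃ h₂ h₃ h₃
  all_goals grind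

theorem stmt_4 {V : Type*} [Fintype V] [DecidableEq V] (G : SimpleGraph V) [DecidableRel G.Adj]
    (hreg : G.IsRegularOfDegree 3) (hbip : G.Colorable 2) :
    (numMatchings G 4 : ℤ) * ((G.edgeFinset.card : ℤ) - 4) =
      5 * numMatchings G 5 + 2 * numSubgraphs G (pathGraph 3 ⊕g pathGraph 2 ⊕g pathGraph 2 ⊕g pathGraph 2) + numSubgraphs G (pathGraph 4 ⊕g pathGraph 2 ⊕g pathGraph 2) := by
  have hverts₃ : ∀ a, ∃ b, s(a, b) ∈ edgesPathThree := by
    rintro (((a | a) | a) | a) <;> decide +revert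
  have hverts₄ : ∀ a, ∃ b, s(a, b) ∈ edgesPathFour := by decide
  simp only [mem_edgesPathThree] at hverts₃
  simp only [mem_edgesPathFour] at hverts₄
  classical
  have hthree := numSubgraphs_eq_card G
    (pathGraph 3 ⊕g pathGraph 2 ⊕g pathGraph 2 ⊕g pathGraph 2)
    hverts₃ edgesPathThree mem_edgesPathThree
  have hfour := numSubgraphs_eq_card G (pathGraph 4 ⊕g pathGraph 2 ⊕g pathGraph 2)
    hverts₄ edgesPathFour mem_edgesPathFour
  rw [show edgesPathThree.card = 5 by decide] at hthree
  rw [show edgesPathFour.card = 5 by decide] at hfour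
  have hcount := sum_card_matchingDeletions G.edgeFinset 4
  rw [← numMatchings_eq_card, Finset.sum_congr rfl fun S hS => card_matchingDeletions_eq
      (Finset.mem_powersetCard.1 hS).2 fun e he => G.not_isDiag_of_mem_edgeFinset
        ((Finset.mem_powersetCard.1 hS).1 he),
    Finset.sum_add_distrib, Finset.sum_add_distrib, ← Finset.mul_sum, ← Finset.mul_sum,
    ← Finset.card_filter, ← Finset.card_filter, ← Finset.card_filter] at hcount
  have hfive := numMatchings_eq_card G 5
  have hlarge : numMatchings G 4 = 0 ∨ 4 ≤ G.edgeFinset.card := by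
    by_contra! hcon
    refine hcon.1 ?_
    rw [numMatchings_eq_card, Finset.powersetCard_eq_empty.2 hcon.2]
    rfl
  have hcount' : numMatchings G 4 * (G.edgeFinset.card - 4) = 5 * numMatchings G 5 +
      2 * numSubgraphs G (pathGraph 3 ⊕g pathGraph 2 ⊕g pathGraph 2 ⊕g pathGraph 2) +
      numSubgraphs G (pathGraph 4 ⊕g pathGraph 2 ⊕g pathGraph 2) := by
    rw [← hcount, hfive, hthree, hfour]
  rcases hlarge with h | h
  · rw [h, zero_mul] at hcount'
    rw [h]
    push_cast
    omega
  · zify [h] at hcount'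
    exact hcount'
end

section
/- Let G be a finite simple 3-regular bipartite graph. Then 12·M(G,3) = N(P₃+2K₂) + 4·N(C₄+K₂) + 2·N(P₄+K₂) + N(P₅). -/
open SimpleGraph

namespace SimpleGraph

section Copy

variable {V W : Type*} {G : SimpleGraph V} {X : SimpleGraph W}

lemma Subgraph.toSubgraph_coeCopy_comp (H : G.Subgraph) (e : X ≃g H.coe) :
    (H.coeCopy.comp e.toCopy).toSubgraph = H := by
  have : (H.coeCopy.comp e.toCopy).toHom = H.hom.comp e.toHom := rfl
  rw [Copy.toSubgraph, this]
  simp [Subgraph.map_comp]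

lemma bijective_sigma_iso_copy (G : SimpleGraph V) (X : SimpleGraph W) :
    Function.Bijective
      (fun p : (Σ H : {H : G.Subgraph | Nonempty (H.coe ≃g X)}, X ≃g H.1.coe) =>
        p.1.1.coeCopy.comp p.2.toCopy) := by
  constructor
  · rintro ⟨⟨H, hH⟩, e⟩ ⟨⟨H', hH'⟩, e'⟩ h
    have hs := congrArg Copy.toSubgraph h
    simp only [Subgraph.toSubgraph_coeCopy_comp] at hs
    subst hs
    congr 1
    ext x
    exact congrArg (fun f : Copy X G => f x) h
  · intro f
    refine ⟨⟨⟨f.toSubgraph, ⟨f.isoToSubgraph.symm⟩⟩, f.isoToSubgraph⟩, ?_⟩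
    ext x
    rfl

lemma card_copy_eq_numSubgraphs_mul_card_iso [Finite V] [Finite W]
    (G : SimpleGraph V) (X : SimpleGraph W) :
    Nat.card (Copy X G) = numSubgraphs G X * Nat.card (X ≃g X) := by
  classical
  have := Fintype.ofFinite V
  have := Fintype.ofFinite {H : G.Subgraph | Nonempty (H.coe ≃g X)}
  have (H : {H : G.Subgraph | Nonempty (H.coe ≃g X)}) : Finite (X ≃g H.1.coe) :=
    Finite.of_injective (fun e => (e : W → H.1.verts)) DFunLike.coe_injective
  rw [← Nat.card_congr (Equiv.ofBijective _ (bijective_sigma_iso_copy G X)), Nat.card_sigma,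
    Finset.sum_congr rfl (g := fun _ => Nat.card (X ≃g X))]
  · simp [numSubgraphs, Set.ncard_eq_toFinset_card']
  · rintro ⟨H, ⟨e⟩⟩ -
    exact Nat.card_congr ⟨fun f => e.comp f, fun f => e.symm.comp f,
      fun f => by ext; simp, fun f => by ext; simp⟩

lemma numSubgraphs_self [Finite W] (X : SimpleGraph W) : numSubgraphs X X = 1 := by
  rw [numSubgraphs, Set.ncard_eq_one]
  refine ⟨⊤, Set.eq_singleton_iff_unique_mem.2 ⟨⟨Subgraph.topIso⟩, ?_⟩⟩
  rintro H ⟨e⟩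
  set f := H.coeCopy.comp e.symm.toCopy with hf
  rw [← H.toSubgraph_coeCopy_comp e.symm, ← hf]
  have hs : Function.Surjective f := Finite.surjective_of_injective f.injective
  have hE := Finite.surjective_of_injective f.mapEdgeSet.injective
  ext x y
  · simpa [Copy.toSubgraph] using hs x
  · simp only [Copy.toSubgraph, Subgraph.map_adj, Subgraph.top_adj, Relation.map_apply]
    constructor
    · rintro ⟨a, b, h, rfl, rfl⟩
      exact f.toHom.map_adj h
    · intro h
      obtain ⟨⟨z, hz⟩, hz'⟩ := hE ⟨s(x, y), h⟩
      induction z with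
      | _ a b =>
        have : s(f a, f b) = s(x, y) := congrArg Subtype.val hz'
        rcases Sym2.eq_iff.1 this with ⟨rfl, rfl⟩ | ⟨rfl, rfl⟩
        · exact ⟨a, b, hz, rfl, rfl⟩
        · exact ⟨b, a, hz.symm, rfl, rfl⟩

/-- In a finite graph, a graph `X` has as many labelled copies as its number of
unlabelled copies times the number of labelled copies of `X` in itself. -/
lemma card_copy_eq_numSubgraphs_mul [Finite V] [Finite W]
    (G : SimpleGraph V) (X : SimpleGraph W) :
    Nat.card (Copy X G) = numSubgraphs G X * Nat.card (Copy X X) := by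
  rw [card_copy_eq_numSubgraphs_mul_card_iso, card_copy_eq_numSubgraphs_mul_card_iso X X,
    numSubgraphs_self, one_mul]

end Copy

section LabelledCopies

lemma card_copy_eq_card_filter {V W T : Type*} [Fintype T] {G : SimpleGraph V} {X : SimpleGraph W} (e : (W → V) → T)
    (e' : T → W → V) (hl : ∀ f, e' (e f) = f) (hr : ∀ t, e (e' t) = t)
    (P : T → Prop) [DecidablePred P]
    (h : ∀ f : W → V, ((∀ x y, X.Adj x y → G.Adj (f x) (f y)) ∧ ∀ x y, f x = f y → x = y) ↔
      P (e f)) :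
    Nat.card (Copy X G) = (Finset.univ.filter P).card := by
  rw [← Fintype.card_subtype, ← Nat.card_eq_fintype_card]
  have h₁ (f : Copy X G) := (h f).1 ⟨fun _ _ h => f.toHom.map_adj h, fun _ _ h => f.injective h⟩
  have h₂ (t : {t // P t}) := (h (e' t.1)).2 ((hr t.1).symm ▸ t.2)
  exact Nat.card_congr ⟨fun f => ⟨e f, h₁ f⟩,
    fun t => ⟨⟨e' t.1, fun {x y} => (h₂ t).1 x y⟩, fun x y => (h₂ t).2 x y⟩,
    fun f => Copy.ext fun x => congrFun (hl f) x, fun t => Subtype.ext (hr t)⟩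

variable {V : Type*} [Fintype V] [DecidableEq V] (G : SimpleGraph V) [DecidableRel G.Adj]

/-- Labelled copies of three disjoint edges `a b`, `u v`, `x y`. -/
def edgeEdgeEdge : Finset (V × V × V × V × V × V) :=
  {(a, b, u, v, x, y) | G.Adj a b ∧ (u ≠ a ∧ u ≠ b) ∧ (G.Adj u v ∧ v ≠ a ∧ v ≠ b) ∧
    (x ≠ a ∧ x ≠ b ∧ x ≠ u ∧ x ≠ v) ∧ G.Adj x y ∧ y ≠ a ∧ y ≠ b ∧ y ≠ u ∧ y ≠ v}

/-- Labelled copies of the disjoint union of a path `c a b d` and edges `u v`, `x y`. -/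
def pathEdgeEdge : Finset (V × V × V × V × V × V × V × V) :=
  {(c, a, b, d, u, v, x, y) | G.Adj c a ∧ (G.Adj a b ∧ b ≠ c) ∧ (G.Adj b d ∧ d ≠ a ∧ d ≠ c) ∧
    (u ≠ c ∧ u ≠ a ∧ u ≠ b ∧ u ≠ d) ∧ (G.Adj u v ∧ v ≠ c ∧ v ≠ a ∧ v ≠ b ∧ v ≠ d) ∧
    (x ≠ c ∧ x ≠ a ∧ x ≠ b ∧ x ≠ d ∧ x ≠ u ∧ x ≠ v) ∧
    G.Adj x y ∧ y ≠ c ∧ y ≠ a ∧ y ≠ b ∧ y ≠ d ∧ y ≠ u ∧ y ≠ v}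

/-- Labelled copies of the disjoint union of a cycle `c a b d` and an edge `x y`. -/
def cycleEdge : Finset (V × V × V × V × V × V) :=
  {(c, a, b, d, x, y) | G.Adj c a ∧ (G.Adj a b ∧ b ≠ c) ∧ (G.Adj b d ∧ G.Adj d c ∧ d ≠ a) ∧
    (x ≠ c ∧ x ≠ a ∧ x ≠ b ∧ x ≠ d) ∧ G.Adj x y ∧ y ≠ c ∧ y ≠ a ∧ y ≠ b ∧ y ≠ d}

/-- Labelled copies of the disjoint union of a path `e c a b d` and an edge `x y`. -/
def pathEdge : Finset (V × V × V × V × V × V × V) :=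
  {(e, c, a, b, d, x, y) | G.Adj e c ∧ (G.Adj c a ∧ a ≠ e) ∧ (G.Adj a b ∧ b ≠ e ∧ b ≠ c) ∧
    (G.Adj b d ∧ d ≠ e ∧ d ≠ c ∧ d ≠ a) ∧ (x ≠ e ∧ x ≠ c ∧ x ≠ a ∧ x ≠ b ∧ x ≠ d) ∧
    G.Adj x y ∧ y ≠ e ∧ y ≠ c ∧ y ≠ a ∧ y ≠ b ∧ y ≠ d}

/-- Labelled copies of a path `e c a b d f`. -/
def pathSix : Finset (V × V × V × V × V × V) :=
  {(e, c, a, b, d, f) | G.Adj e c ∧ (G.Adj c a ∧ a ≠ e) ∧ (G.Adj a b ∧ b ≠ e ∧ b ≠ c) ∧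
    (G.Adj b d ∧ d ≠ e ∧ d ≠ c ∧ d ≠ a) ∧ G.Adj d f ∧ f ≠ e ∧ f ≠ c ∧ f ≠ a ∧ f ≠ b}

variable {G}

lemma card_copy_edgeEdgeEdge :
    Nat.card (Copy (pathGraph 2 ⊕g pathGraph 2 ⊕g pathGraph 2) G) = (edgeEdgeEdge G).card := by
  refine card_copy_eq_card_filter
    (fun f => (f (.inl (.inl 0)), f (.inl (.inl 1)), f (.inl (.inr 0)), f (.inl (.inr 1)),
        f (.inr 0), f (.inr 1)))
      (fun (a, b, u, v, x, y) => Sum.elim (Sum.elim ![a, b] ![u, v]) ![x, y])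
      (fun f => ?_) (fun t => rfl) _ fun f => ?_
  · ext ((i | i) | i) <;> fin_cases i <;> rfl
  · simp [Sum.forall, Fin.forall_fin_succ, pathGraph_adj]
    constructor <;> intro h <;> casesm* _ ∧ _ <;> constructorm* _ ∧ _ <;>
      first
      | assumption
      | exact Ne.symm ‹_›
      | exact SimpleGraph.Adj.symm ‹_›
      | exact SimpleGraph.Adj.ne ‹_›
      | exact SimpleGraph.Adj.ne' ‹_›

lemma card_copy_pathEdgeEdge :
    Nat.card (Copy (pathGraph 4 ⊕g pathGraph 2 ⊕g pathGraph 2) G) = (pathEdgeEdge G).card := by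
  refine card_copy_eq_card_filter
    (fun f => (f (.inl (.inl 0)), f (.inl (.inl 1)), f (.inl (.inl 2)), f (.inl (.inl 3)),
        f (.inl (.inr 0)), f (.inl (.inr 1)), f (.inr 0), f (.inr 1)))
      (fun (c, a, b, d, u, v, x, y) => Sum.elim (Sum.elim ![c, a, b, d] ![u, v]) ![x, y])
      (fun f => ?_) (fun t => rfl) _ fun f => ?_
  · ext ((i | i) | i) <;> fin_cases i <;> rfl
  · simp [Sum.forall, Fin.forall_fin_succ, pathGraph_adj]
    constructor <;> intro h <;> casesm* _ ∧ _ <;> constructorm* _ ∧ _ <;>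
      first
      | assumption
      | exact Ne.symm ‹_›
      | exact SimpleGraph.Adj.symm ‹_›
      | exact SimpleGraph.Adj.ne ‹_›
      | exact SimpleGraph.Adj.ne' ‹_›

lemma card_copy_cycleEdge :
    Nat.card (Copy (cycleGraph 4 ⊕g pathGraph 2) G) = (cycleEdge G).card := by
  refine card_copy_eq_card_filter
    (fun f => (f (.inl 0), f (.inl 1), f (.inl 2), f (.inl 3), f (.inr 0), f (.inr 1)))
      (fun (c, a, b, d, x, y) => Sum.elim ![c, a, b, d] ![x, y])
      (fun f => ?_) (fun t => rfl) _ fun f => ?_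
  · ext (i | i) <;> fin_cases i <;> rfl
  · have h (i j : Fin 4) : (cycleGraph 4).Adj i j ↔
        (i.val + 1) % 4 = j.val ∨ (j.val + 1) % 4 = i.val := by
      decide +revert
    simp [Sum.forall, Fin.forall_fin_succ, pathGraph_adj, h]
    constructor <;> intro h <;> casesm* _ ∧ _ <;> constructorm* _ ∧ _ <;>
      first
      | assumption
      | exact Ne.symm ‹_›
      | exact SimpleGraph.Adj.symm ‹_›
      | exact SimpleGraph.Adj.ne ‹_›
      | exact SimpleGraph.Adj.ne' ‹_›

lemma card_copy_pathEdge :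
    Nat.card (Copy (pathGraph 5 ⊕g pathGraph 2) G) = (pathEdge G).card := by
  refine card_copy_eq_card_filter
    (fun f => (f (.inl 0), f (.inl 1), f (.inl 2), f (.inl 3), f (.inl 4), f (.inr 0), f (.inr 1)))
      (fun (e, c, a, b, d, x, y) => Sum.elim ![e, c, a, b, d] ![x, y])
      (fun f => ?_) (fun t => rfl) _ fun f => ?_
  · ext (i | i) <;> fin_cases i <;> rfl
  · simp [Sum.forall, Fin.forall_fin_succ, pathGraph_adj]
    constructor <;> intro h <;> casesm* _ ∧ _ <;> constructorm* _ ∧ _ <;>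
      first
      | assumption
      | exact Ne.symm ‹_›
      | exact SimpleGraph.Adj.symm ‹_›
      | exact SimpleGraph.Adj.ne ‹_›
      | exact SimpleGraph.Adj.ne' ‹_›

lemma card_copy_pathSix :
    Nat.card (Copy (pathGraph 6) G) = (pathSix G).card := by
  refine card_copy_eq_card_filter
    (fun f => (f 0, f 1, f 2, f 3, f 4, f 5)) (fun (e, c, a, b, d, f) => ![e, c, a, b, d, f])
      (fun f => ?_) (fun t => rfl) _ fun f => ?_
  · ext i
    fin_cases i <;> rfl
  · simp [Fin.forall_fin_succ, pathGraph_adj]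
    constructor <;> intro h <;> casesm* _ ∧ _ <;> constructorm* _ ∧ _ <;>
      first
      | assumption
      | exact Ne.symm ‹_›
      | exact SimpleGraph.Adj.symm ‹_›
      | exact SimpleGraph.Adj.ne ‹_›
      | exact SimpleGraph.Adj.ne' ‹_›

end LabelledCopies

section Automorphisms

instance (n : ℕ) : DecidableRel (pathGraph n).Adj :=
  fun _ _ => decidable_of_iff _ pathGraph_adj.symm

instance {V W : Type*} (G : SimpleGraph V) (H : SimpleGraph W) [DecidableRel G.Adj]
    [DecidableRel H.Adj] : DecidableRel (G ⊕g H).Adj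
  | .inl _, .inl _ => decidable_of_iff _ sum_adj_inl.symm
  | .inr _, .inr _ => decidable_of_iff _ sum_adj_inr.symm
  | .inl _, .inr _ => .isFalse (by simp)
  | .inr _, .inl _ => .isFalse (by simp)

lemma card_edgeEdgeEdge_self :
    (edgeEdgeEdge (pathGraph 2 ⊕g pathGraph 2 ⊕g pathGraph 2)).card = 48 := by
  simp only [edgeEdgeEdge, Finset.card_filter, Fintype.sum_prod_type, ite_and,
    Finset.sum_ite_irrel, Finset.sum_const_zero]
  decide +kernel

lemma card_pathEdgeEdge_self :
    (pathEdgeEdge (pathGraph 4 ⊕g pathGraph 2 ⊕g pathGraph 2)).card = 16 := by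
  simp only [pathEdgeEdge, Finset.card_filter, Fintype.sum_prod_type, ite_and,
    Finset.sum_ite_irrel, Finset.sum_const_zero]
  decide +kernel

lemma card_cycleEdge_self : (cycleEdge (cycleGraph 4 ⊕g pathGraph 2)).card = 16 := by
  simp only [cycleEdge, Finset.card_filter, Fintype.sum_prod_type, ite_and,
    Finset.sum_ite_irrel, Finset.sum_const_zero]
  decide +kernel

lemma card_pathEdge_self : (pathEdge (pathGraph 5 ⊕g pathGraph 2)).card = 4 := by
  simp only [pathEdge, Finset.card_filter, Fintype.sum_prod_type, ite_and,
    Finset.sum_ite_irrel, Finset.sum_const_zero]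
  decide +kernel

lemma card_pathSix_self : (pathSix (pathGraph 6)).card = 2 := by
  simp only [pathSix, Finset.card_filter, Fintype.sum_prod_type, ite_and,
    Finset.sum_ite_irrel, Finset.sum_const_zero]
  decide +kernel

end Automorphisms

section Counting

variable {V : Type*} [Fintype V] [DecidableEq V] (G : SimpleGraph V) [DecidableRel G.Adj]

/-- Labelled triples of disjoint edges `a b`, `u v`, `x y`, together with a neighbor `c ≠ b` of `a`
and a neighbor `d ≠ a` of `b`. -/
def extendedTriples : Finset (Σ _ : V × V × V × V × V × V, V × V) :=
  (edgeEdgeEdge G).sigma fun t => (G.neighborFinset t.1).erase t.2.1 ×ˢ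
    (G.neighborFinset t.2.1).erase t.1

variable {G}

lemma mem_extendedTriples {a b u v x y c d : V} :
    ⟨(a, b, u, v, x, y), (c, d)⟩ ∈ extendedTriples G ↔
      (a, b, u, v, x, y) ∈ edgeEdgeEdge G ∧ (c ≠ b ∧ G.Adj a c) ∧ d ≠ a ∧ G.Adj b d := by
  simp [extendedTriples]

lemma card_extendedTriples (hreg : G.IsRegularOfDegree 3) :
    (extendedTriples G).card = 4 * (edgeEdgeEdge G).card := by
  rw [extendedTriples, Finset.card_sigma, Finset.sum_const_nat (m := 4), mul_comm]
  rintro ⟨a, b, u, v, x, y⟩ h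
  have hab : G.Adj a b := by
    simp only [edgeEdgeEdge, Finset.mem_filter] at h
    exact h.2.1
  rw [Finset.card_product, Finset.card_erase_of_mem (by simpa using hab),
    Finset.card_erase_of_mem (by simpa using hab.symm)]
  simp [hreg a, hreg b]

variable (G) in
/-- The sum of `f c d u v x y` over the extended triples of disjoint edges. -/
def sumExtended (f : V → V → V → V → V → V → ℕ) : ℕ :=
  ∑ p ∈ extendedTriples G,
    f p.2.1 p.2.2 p.1.2.2.1 p.1.2.2.2.1 p.1.2.2.2.2.1 p.1.2.2.2.2.2

lemma sumExtended_add (f g : V → V → V → V → V → V → ℕ) :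
    sumExtended G (fun c d u v x y => f c d u v x y + g c d u v x y) =
      sumExtended G f + sumExtended G g :=
  Finset.sum_add_distrib

lemma sumExtended_flip (f : V → V → V → V → V → V → ℕ) :
    sumExtended G (fun c d u v x y => f c d v u x y) = sumExtended G f := by
  refine Finset.sum_nbij'
    (fun ⟨(a, b, u, v, x, y), q⟩ => ⟨(a, b, v, u, x, y), q⟩)
    (fun ⟨(a, b, u, v, x, y), q⟩ => ⟨(a, b, v, u, x, y), q⟩) ?_ ?_
    (fun _ _ => rfl) (fun _ _ => rfl) (fun _ _ => rfl)
  all_goals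
    rintro ⟨⟨a, b, u, v, x, y⟩, c, d⟩
    simp only [mem_extendedTriples, edgeEdgeEdge, Finset.mem_filter, Finset.mem_univ, true_and]
    grind [SimpleGraph.adj_comm, SimpleGraph.irrefl]

lemma sumExtended_swap (f : V → V → V → V → V → V → ℕ) :
    sumExtended G (fun c d u v x y => f c d x y u v) = sumExtended G f := by
  refine Finset.sum_nbij'
    (fun ⟨(a, b, u, v, x, y), q⟩ => ⟨(a, b, x, y, u, v), q⟩)
    (fun ⟨(a, b, u, v, x, y), q⟩ => ⟨(a, b, x, y, u, v), q⟩) ?_ ?_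
    (fun _ _ => rfl) (fun _ _ => rfl) (fun _ _ => rfl)
  all_goals
    rintro ⟨⟨a, b, u, v, x, y⟩, c, d⟩
    simp only [mem_extendedTriples, edgeEdgeEdge, Finset.mem_filter, Finset.mem_univ, true_and]
    grind [SimpleGraph.adj_comm, SimpleGraph.irrefl]

/-- Indicator that neither `c` nor `d` meets the edges `u v` and `x y`. -/
def meetNone (c d u v x y : V) : ℕ :=
  if (c ≠ u ∧ c ≠ v ∧ c ≠ x ∧ c ≠ y) ∧ d ≠ u ∧ d ≠ v ∧ d ≠ x ∧ d ≠ y then 1 else 0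

/-- Indicator that `c = u`, while `d` does not meet the edges `u v` and `x y`. -/
def meetLeft (c d u v x y : V) : ℕ :=
  if c = u ∧ d ≠ u ∧ d ≠ v ∧ d ≠ x ∧ d ≠ y then 1 else 0

/-- Indicator that `d = u`, while `c` does not meet the edges `u v` and `x y`. -/
def meetRight (c d u v x y : V) : ℕ :=
  if (c ≠ u ∧ c ≠ v ∧ c ≠ x ∧ c ≠ y) ∧ d = u then 1 else 0

/-- Indicator that `c = u` and `d = v`. -/
def meetSame (c d u v _x _y : V) : ℕ :=
  if c = u ∧ d = v then 1 else 0

/-- Indicator that `c = u` and `d = x`. -/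
def meetBoth (c d u _v x _y : V) : ℕ :=
  if c = u ∧ d = x then 1 else 0

lemma sumExtended_meetNone (htri : ∀ a b c, G.Adj a b → G.Adj b c → ¬ G.Adj c a) :
    sumExtended G meetNone = (pathEdgeEdge G).card := by
  simp only [sumExtended, meetNone, ← Finset.card_filter]
  refine Finset.card_nbij'
    (fun ⟨(a, b, u, v, x, y), c, d⟩ => (c, a, b, d, u, v, x, y))
    (fun (c, a, b, d, u, v, x, y) => ⟨(a, b, u, v, x, y), c, d⟩) ?_ ?_
    (fun _ _ => rfl) (fun _ _ => rfl)
  · rintro ⟨⟨a, b, u, v, x, y⟩, c, d⟩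
    simp only [Finset.coe_filter, Set.mem_ofPred_eq, mem_extendedTriples,
      edgeEdgeEdge, pathEdgeEdge, Finset.mem_filter, Finset.mem_univ, true_and]
    grind [SimpleGraph.adj_comm, SimpleGraph.irrefl]
  · rintro ⟨c, a, b, d, u, v, x, y⟩
    simp only [Finset.coe_filter, Set.mem_ofPred_eq, mem_extendedTriples,
      edgeEdgeEdge, pathEdgeEdge, Finset.mem_filter, Finset.mem_univ, true_and]
    grind [SimpleGraph.adj_comm, SimpleGraph.irrefl]

lemma sumExtended_meetLeft :
    sumExtended G meetLeft = (pathEdge G).card := by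
  simp only [sumExtended, meetLeft, ← Finset.card_filter]
  refine Finset.card_nbij'
    (fun ⟨(a, b, _, v, x, y), c, d⟩ => (v, c, a, b, d, x, y))
    (fun (e, c, a, b, d, x, y) => ⟨(a, b, c, e, x, y), c, d⟩) ?_ ?_ ?_
    (fun _ _ => rfl)
  · rintro ⟨⟨a, b, u, v, x, y⟩, c, d⟩
    simp only [Finset.coe_filter, Set.mem_ofPred_eq, mem_extendedTriples,
      edgeEdgeEdge, pathEdge, Finset.mem_filter, Finset.mem_univ, true_and]
    grind [SimpleGraph.adj_comm, SimpleGraph.irrefl]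
  · rintro ⟨e, c, a, b, d, x, y⟩
    simp only [Finset.coe_filter, Set.mem_ofPred_eq, mem_extendedTriples,
      edgeEdgeEdge, pathEdge, Finset.mem_filter, Finset.mem_univ, true_and]
    grind [SimpleGraph.adj_comm, SimpleGraph.irrefl]
  · rintro ⟨⟨a, b, u, v, x, y⟩, c, d⟩ h
    simp only [Finset.coe_filter, Set.mem_ofPred_eq] at h
    simp [h]

lemma sumExtended_meetRight :
    sumExtended G meetRight = (pathEdge G).card := by
  simp only [sumExtended, meetRight, ← Finset.card_filter]
  refine Finset.card_nbij'
    (fun ⟨(a, b, _, v, x, y), c, d⟩ => (v, d, b, a, c, x, y))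
    (fun (e, d, b, a, c, x, y) => ⟨(a, b, d, e, x, y), c, d⟩) ?_ ?_ ?_
    (fun _ _ => rfl)
  · rintro ⟨⟨a, b, u, v, x, y⟩, c, d⟩
    simp only [Finset.coe_filter, Set.mem_ofPred_eq, mem_extendedTriples,
      edgeEdgeEdge, pathEdge, Finset.mem_filter, Finset.mem_univ, true_and]
    grind [SimpleGraph.adj_comm, SimpleGraph.irrefl]
  · rintro ⟨e, d, b, a, c, x, y⟩
    simp only [Finset.coe_filter, Set.mem_ofPred_eq, mem_extendedTriples,
      edgeEdgeEdge, pathEdge, Finset.mem_filter, Finset.mem_univ, true_and]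
    grind [SimpleGraph.adj_comm, SimpleGraph.irrefl]
  · rintro ⟨⟨a, b, u, v, x, y⟩, c, d⟩ h
    simp only [Finset.coe_filter, Set.mem_ofPred_eq] at h
    simp [h]

lemma sumExtended_meetSame : sumExtended G meetSame = (cycleEdge G).card := by
  simp only [sumExtended, meetSame, ← Finset.card_filter]
  refine Finset.card_nbij'
    (fun ⟨(a, b, _, _, x, y), c, d⟩ => (c, a, b, d, x, y))
    (fun (c, a, b, d, x, y) => ⟨(a, b, c, d, x, y), c, d⟩) ?_ ?_ ?_
    (fun _ _ => rfl)
  · rintro ⟨⟨a, b, u, v, x, y⟩, c, d⟩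
    simp only [Finset.coe_filter, Set.mem_ofPred_eq, mem_extendedTriples,
      edgeEdgeEdge, cycleEdge, Finset.mem_filter, Finset.mem_univ, true_and]
    grind [SimpleGraph.adj_comm, SimpleGraph.irrefl]
  · rintro ⟨c, a, b, d, x, y⟩
    simp only [Finset.coe_filter, Set.mem_ofPred_eq, mem_extendedTriples,
      edgeEdgeEdge, cycleEdge, Finset.mem_filter, Finset.mem_univ, true_and]
    grind [SimpleGraph.adj_comm, SimpleGraph.irrefl]
  · rintro ⟨⟨a, b, u, v, x, y⟩, c, d⟩ h
    simp only [Finset.coe_filter, Set.mem_ofPred_eq] at h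
    simp [h]

lemma sumExtended_meetBoth : sumExtended G meetBoth = (pathSix G).card := by
  simp only [sumExtended, meetBoth, ← Finset.card_filter]
  refine Finset.card_nbij'
    (fun ⟨(a, b, _, v, _, y), c, d⟩ => (v, c, a, b, d, y))
    (fun (e, c, a, b, d, f) => ⟨(a, b, c, e, d, f), c, d⟩) ?_ ?_ ?_
    (fun _ _ => rfl)
  · rintro ⟨⟨a, b, u, v, x, y⟩, c, d⟩
    simp only [Finset.coe_filter, Set.mem_ofPred_eq, mem_extendedTriples,
      edgeEdgeEdge, pathSix, Finset.mem_filter, Finset.mem_univ, true_and]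
    grind [SimpleGraph.adj_comm, SimpleGraph.irrefl]
  · rintro ⟨e, c, a, b, d, f⟩
    simp only [Finset.coe_filter, Set.mem_ofPred_eq, mem_extendedTriples,
      edgeEdgeEdge, pathSix, Finset.mem_filter, Finset.mem_univ, true_and]
    grind [SimpleGraph.adj_comm, SimpleGraph.irrefl]
  · rintro ⟨⟨a, b, u, v, x, y⟩, c, d⟩ h
    simp only [Finset.coe_filter, Set.mem_ofPred_eq] at h
    simp [h]

/-- The sum of `f` over the four ways to choose `u` and then `v` among the endpoints of two
edges. -/
def orbitSum (f : V → V → V → V → V → V → ℕ) (c d u v x y : V) : ℕ :=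
  f c d u v x y + f c d v u x y + (f c d x y u v + f c d y x u v)

lemma sumExtended_orbitSum (f : V → V → V → V → V → V → ℕ) :
    sumExtended G (orbitSum f) = 4 * sumExtended G f := by
  have h := (sumExtended_swap (G := G) (fun c d u v x y => f c d v u x y)).trans
    (sumExtended_flip f)
  unfold orbitSum
  rw [sumExtended_add, sumExtended_add, sumExtended_add, sumExtended_flip f, sumExtended_swap f, h]
  ring

lemma card_extendedTriples_eq_sumExtended
    (htri : ∀ a b c, G.Adj a b → G.Adj b c → ¬ G.Adj c a) :
    (extendedTriples G).card = sumExtended G (fun c d u v x y => meetNone c d u v x y +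
      orbitSum (fun c d u v x y => meetLeft c d u v x y + (meetRight c d u v x y +
        (meetSame c d u v x y + (meetBoth c d u v x y + meetBoth c d u v y x)))) c d u v x y) := by
  rw [sumExtended, Finset.card_eq_sum_ones]
  refine Finset.sum_congr rfl ?_
  rintro ⟨⟨a, b, u, v, x, y⟩, c, d⟩ h
  simp only [mem_extendedTriples, edgeEdgeEdge, Finset.mem_filter, Finset.mem_univ, true_and] at h
  obtain ⟨⟨hab, -, ⟨huv, -, -⟩, ⟨-, -, hxu, hxv⟩, hxy, -, -, hyu, hyv⟩, ⟨-, hac⟩, -, hbd⟩ := h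
  have hcd : c ≠ d := by
    rintro rfl
    exact htri a b c hab hbd hac.symm
  have := huv.ne
  have := hxy.ne
  simp only [orbitSum, meetNone, meetLeft, meetRight, meetSame, meetBoth]
  by_cases h₁ : c = u ∨ c = v ∨ c = x ∨ c = y <;> by_cases h₂ : d = u ∨ d = v ∨ d = x ∨ d = y
  · rcases h₁ with rfl | rfl | rfl | rfl <;> rcases h₂ with rfl | rfl | rfl | rfl <;> grind
  · rcases h₁ with rfl | rfl | rfl | rfl <;> grind
  · rcases h₂ with rfl | rfl | rfl | rfl <;> grind
  · grind

/-- Every edge of a triple of disjoint edges in a cubic triangle-free graph extends in four ways to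
a path with three edges, which may run into the other two edges. -/
lemma four_mul_card_edgeEdgeEdge (hreg : G.IsRegularOfDegree 3)
    (htri : ∀ a b c, G.Adj a b → G.Adj b c → ¬ G.Adj c a) :
    4 * (edgeEdgeEdge G).card = (pathEdgeEdge G).card + 4 * (cycleEdge G).card +
      8 * (pathEdge G).card + 8 * (pathSix G).card := by
  have h : sumExtended G (fun c d u v x y => meetBoth c d u v y x) = sumExtended G meetBoth :=
    (sumExtended_swap (fun c d u v x y => meetBoth c d x y v u)).trans
      ((sumExtended_flip (fun c d u v x y => meetBoth c d x y u v)).trans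
        (sumExtended_swap meetBoth))
  rw [← card_extendedTriples hreg, card_extendedTriples_eq_sumExtended htri, sumExtended_add,
    sumExtended_orbitSum, sumExtended_add, sumExtended_add, sumExtended_add, sumExtended_add, h,
    sumExtended_meetNone htri, sumExtended_meetLeft, sumExtended_meetRight,
    sumExtended_meetSame, sumExtended_meetBoth]
  ring

end Counting

section Matchings

variable {V : Type*} {G : SimpleGraph V}

lemma Copy.isMatching_toSubgraph {W : Type*} {X : SimpleGraph W} (f : Copy X G)
    (hX : ∀ w, ∃! w', X.Adj w w') : f.toSubgraph.IsMatching := by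
  rintro _ ⟨w, -, rfl⟩
  obtain ⟨w', h, hw'⟩ := hX w
  refine ⟨f w', ⟨w, w', h, rfl, rfl⟩, ?_⟩
  rintro _ ⟨z, z', hz, hzw, rfl⟩
  obtain rfl := f.injective hzw
  exact congrArg f (hw' z' hz)

lemma Copy.ncard_edgeSet_toSubgraph {W : Type*} {X : SimpleGraph W} (f : Copy X G) :
    f.toSubgraph.edgeSet.ncard = X.edgeSet.ncard := by
  rw [Copy.toSubgraph, Subgraph.edgeSet_map,
    Set.ncard_image_of_injective _ (Sym2.map.injective f.injective)]
  simp

lemma Subgraph.IsMatching.exists_copy {H : G.Subgraph} (hH : H.IsMatching)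
    (h3 : H.edgeSet.ncard = 3) :
    ∃ f : Copy (pathGraph 2 ⊕g pathGraph 2 ⊕g pathGraph 2) G, f.toSubgraph = H := by
  obtain ⟨e₁, e₂, e₃, h₁₂, h₁₃, h₂₃, hE⟩ := Set.ncard_eq_three.1 h3
  induction e₁ with | _ a b
  induction e₂ with | _ u v
  induction e₃ with | _ x y
  have hadj (p q : V) : H.Adj p q ↔ s(p, q) = s(a, b) ∨ s(p, q) = s(u, v) ∨ s(p, q) = s(x, y) := by
    rw [← Subgraph.mem_edgeSet, hE]
    simp
  have huniq (p q r : V) (hq : H.Adj p q) (hr : H.Adj p r) : q = r :=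
    (hH hq.fst_mem).unique hq hr
  have hab : H.Adj a b := by simp [hadj]
  have huv : H.Adj u v := by simp [hadj]
  have hxy : H.Adj x y := by simp [hadj]
  have hdisj (p q r s : V) (hpq : H.Adj p q) (hrs : H.Adj r s) (hne : s(p, q) ≠ s(r, s)) :
      p ≠ r ∧ p ≠ s ∧ q ≠ r ∧ q ≠ s := by
    have := hpq.symm
    have := hrs.symm
    grind [Sym2.eq_iff]
  obtain ⟨hau, hav, hbu, hbv⟩ := hdisj _ _ _ _ hab huv h₁₂
  obtain ⟨hax, hay, hbx, hby⟩ := hdisj _ _ _ _ hab hxy h₁₃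
  obtain ⟨hux, huy, hvx, hvy⟩ := hdisj _ _ _ _ huv hxy h₂₃
  have := hab.ne
  have := huv.ne
  have := hxy.ne
  have hhom : ∀ i j, (pathGraph 2 ⊕g pathGraph 2 ⊕g pathGraph 2).Adj i j →
      H.Adj (Sum.elim (Sum.elim ![a, b] ![u, v]) ![x, y] i)
        (Sum.elim (Sum.elim ![a, b] ![u, v]) ![x, y] j) := by
    simp [Sum.forall, Fin.forall_fin_succ, pathGraph_adj, hab, huv, hxy, hab.symm, huv.symm,
      hxy.symm]
  refine ⟨⟨⟨Sum.elim (Sum.elim ![a, b] ![u, v]) ![x, y], fun h => (hhom _ _ h).adj_sub⟩, ?_⟩, ?_⟩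
  · simp only [Function.Injective, RelHom.coeFn_mk, Sum.forall, Fin.forall_fin_succ]
    simp
    grind
  · have hA (p q : V) : H.Adj p q ↔ ∃ i j, (pathGraph 2 ⊕g pathGraph 2 ⊕g pathGraph 2).Adj i j ∧
        Sum.elim (Sum.elim ![a, b] ![u, v]) ![x, y] i = p ∧
        Sum.elim (Sum.elim ![a, b] ![u, v]) ![x, y] j = q := by
      constructor
      · simp [hadj, Sum.exists, Fin.exists_fin_succ, pathGraph_adj]
        grind
      · rintro ⟨i, j, h, rfl, rfl⟩
        exact hhom _ _ h
    ext p q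
    · constructor
      · rintro ⟨i, -, rfl⟩
        obtain ⟨j, hj⟩ : ∃ j, (pathGraph 2 ⊕g pathGraph 2 ⊕g pathGraph 2).Adj i j := by
          decide +revert
        exact (hhom i j hj).fst_mem
      · intro hp
        obtain ⟨q, hq, -⟩ := hH hp
        obtain ⟨i, j, -, rfl, -⟩ := (hA p q).1 hq
        exact ⟨i, trivial, rfl⟩
    · exact (hA p q).symm

lemma numMatchings_three :
    numMatchings G 3 = numSubgraphs G (pathGraph 2 ⊕g pathGraph 2 ⊕g pathGraph 2) := by
  refine congrArg Set.ncard (Set.ext fun H => ⟨fun ⟨hH, h3⟩ => ?_, fun ⟨e⟩ => ?_⟩)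
  · obtain ⟨f, rfl⟩ := hH.exists_copy h3
    exact ⟨f.isoToSubgraph.symm⟩
  · rw [← H.toSubgraph_coeCopy_comp e.symm]
    refine ⟨Copy.isMatching_toSubgraph _ (by simp only [ExistsUnique]; decide), ?_⟩
    rw [Copy.ncard_edgeSet_toSubgraph, Set.ncard_eq_toFinset_card']
    decide +kernel

end Matchings

end SimpleGraph

theorem stmt_6 {V : Type*} [Fintype V] [DecidableEq V] (G : SimpleGraph V) [DecidableRel G.Adj]
    (hreg : G.IsRegularOfDegree 3) (hbip : G.Colorable 2) :
    12 * numMatchings G 3 =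
      numSubgraphs G (pathGraph 4 ⊕g pathGraph 2 ⊕g pathGraph 2) + 4 * numSubgraphs G (cycleGraph 4 ⊕g pathGraph 2)
        + 2 * numSubgraphs G (pathGraph 5 ⊕g pathGraph 2) + numSubgraphs G (pathGraph 6) := by
  have htri (a b c : V) (hab : G.Adj a b) (hbc : G.Adj b c) : ¬ G.Adj c a := by
    obtain ⟨C⟩ := hbip
    intro hca
    have h₁ := C.valid hab
    have h₂ := C.valid hbc
    have h₃ := C.valid hca
    lia
  have h := four_mul_card_edgeEdgeEdge hreg htri
  have h₁ := card_copy_eq_numSubgraphs_mul G (pathGraph 2 ⊕g pathGraph 2 ⊕g pathGraph 2)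
  have h₂ := card_copy_eq_numSubgraphs_mul G (pathGraph 4 ⊕g pathGraph 2 ⊕g pathGraph 2)
  have h₃ := card_copy_eq_numSubgraphs_mul G (cycleGraph 4 ⊕g pathGraph 2)
  have h₄ := card_copy_eq_numSubgraphs_mul G (pathGraph 5 ⊕g pathGraph 2)
  have h₅ := card_copy_eq_numSubgraphs_mul G (pathGraph 6)
  rw [card_copy_edgeEdgeEdge, card_copy_edgeEdgeEdge, card_edgeEdgeEdge_self] at h₁
  rw [card_copy_pathEdgeEdge, card_copy_pathEdgeEdge, card_pathEdgeEdge_self] at h₂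
  rw [card_copy_cycleEdge, card_copy_cycleEdge, card_cycleEdge_self] at h₃
  rw [card_copy_pathEdge, card_copy_pathEdge, card_pathEdge_self] at h₄
  rw [card_copy_pathSix, card_copy_pathSix, card_pathSix_self] at h₅
  rw [numMatchings_three]
  lia
end
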